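/- arXiv:1712.02526 — 2 statements merged into one kernel-verified Lean document; each statement's English description precedes it below -/
import Mathlib

section
/- For every d ≥ 1, every 0 ≤ i ≤ d−1, and every ε > 0, there exists N such that for all n ≥ N, the complete d-dimensional complex Δ_n^{(d)} on n vertices satisfies 𝓱_i(Δ_n^{(d)}) ≥ 1 − ε. -/
open Finset
open scoped Classical

variable {V : Type}

/-- The `i`-cells of a simplicial complex `X`: faces of size `i+1`. -/
def cells [DecidableEq V] (X : Finset (Finset V)) (i : ℕ) : Finset (Finset V) :=
  X.filter fun F => F.card = i + 1

/-- `deg(F)`: the number of `d`-cells of `X` containing `F`. -/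
def faceDeg [DecidableEq V] (X : Finset (Finset V)) (d : ℕ) (F : Finset V) : ℕ :=
  (X.filter fun G => G.card = d + 1 ∧ F ⊆ G).card

/-- The weight of an `i`-cell `F`: `w(F) = deg(F)/(C(d+1,i+1)·|X^{(d)}|)`. -/
noncomputable def wt [DecidableEq V] (X : Finset (Finset V)) (d i : ℕ) (F : Finset V) : ℝ :=
  (faceDeg X d F : ℝ) / (((d + 1).choose (i + 1) : ℝ) * ((cells X d).card : ℝ))

/-- The norm of an `i`-cochain `f ∈ Cⁱ(X,F₂)`: `‖f‖ = ∑_{F ∈ X^{(i)}, f F ≠ 0} w(F)`. -/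
noncomputable def normC [DecidableEq V] (X : Finset (Finset V)) (d i : ℕ)
    (f : Finset V → ZMod 2) : ℝ :=
  ∑ F ∈ (cells X i).filter (fun F => f F ≠ 0), wt X d i F

/-- `(dlt j g)(F) = ∑_{G ⊆ F, |G| = j} g(G)`; the coboundary `δ_i` is `dlt (i+1)`,
and `δ_{i-1}` (including the augmentation `δ_{-1}` for `i = 0`) is `dlt i`. -/
def dlt [DecidableEq V] (j : ℕ) (g : Finset V → ZMod 2) (F : Finset V) : ZMod 2 :=
  ∑ G ∈ F.powersetCard j, g G

/-- Membership of an `i`-cochain in `Bⁱ = im δ_{i-1}` (agreement on all `i`-cells). -/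
def MemB [DecidableEq V] (X : Finset (Finset V)) (i : ℕ) (f : Finset V → ZMod 2) : Prop :=
  ∃ g : Finset V → ZMod 2, ∀ F ∈ cells X i, f F = dlt i g F

/-- `‖[f]‖`: the minimal norm over the coset `f + Bⁱ`. -/
noncomputable def distB [DecidableEq V] (X : Finset (Finset V)) (d i : ℕ)
    (f : Finset V → ZMod 2) : ℝ :=
  sInf {r : ℝ | ∃ g : Finset V → ZMod 2, r = normC X d i (fun F => f F + dlt i g F)}

theorem card_supersets_of_card [Fintype V] [DecidableEq V] (F : Finset V) {m : ℕ}
    (hm : F.card ≤ m) :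
    ((univ : Finset (Finset V)).filter fun G => G.card = m ∧ F ⊆ G).card =
      (Fintype.card V - F.card).choose (m - F.card) := by
  rw [← card_compl, ← card_powersetCard]
  refine card_bij' (fun G _ => G \ F) (fun G _ => G ∪ F) ?_ ?_ ?_ ?_
  · intro G hG
    simp only [mem_filter, mem_univ, true_and] at hG
    rw [mem_powersetCard, card_sdiff_of_subset hG.2, hG.1]
    exact ⟨fun x hx => by simp_all, rfl⟩
  · intro G hG
    rw [mem_powersetCard] at hG
    have hdisj : Disjoint G F := subset_compl_iff_disjoint_right.mp hG.1
    simp only [mem_filter, mem_univ, true_and]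
    exact ⟨by rw [card_union_of_disjoint hdisj, hG.2]; omega, subset_union_right⟩
  · intro G hG
    simp only [mem_filter, mem_univ, true_and] at hG
    exact sdiff_union_of_subset hG.2
  · intro G hG
    rw [mem_powersetCard] at hG
    exact union_sdiff_cancel_right (subset_compl_iff_disjoint_right.mp hG.1)

theorem wt_complete [Fintype V] [DecidableEq V] {d i : ℕ} (hid : i ≤ d)
    (hd : d + 1 ≤ Fintype.card V) {F : Finset V} (hF : F.card = i + 1) :
    wt ((univ : Finset (Finset V)).filter fun F => F.card ≤ d + 1) d i F =
      1 / ((Fintype.card V).choose (i + 1) : ℝ) := by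
  have hdeg : faceDeg ((univ : Finset (Finset V)).filter fun F => F.card ≤ d + 1) d F =
      (Fintype.card V - (i + 1)).choose (d + 1 - (i + 1)) := by
    rw [← hF, ← card_supersets_of_card F (by omega), faceDeg, filter_filter]
    congr 1
    ext G
    simp only [mem_filter, mem_univ, true_and]
    exact ⟨fun h => h.2, fun h => ⟨h.1.le, h⟩⟩
  have hcells : (cells ((univ : Finset (Finset V)).filter fun F => F.card ≤ d + 1) d).card =
      (Fintype.card V).choose (d + 1) := by
    rw [← card_univ, ← card_powersetCard, cells, filter_filter]
    congr 1
    ext G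
    simp only [mem_filter, mem_univ, true_and, mem_powersetCard, subset_univ]
    omega
  have hchoose := Nat.choose_mul (n := Fintype.card V) (show i + 1 ≤ d + 1 by omega)
  have h₁ : ((Fintype.card V).choose (i + 1) : ℝ) ≠ 0 := by
    exact_mod_cast (Nat.choose_pos (by omega)).ne'
  have h₂ : ((Fintype.card V).choose (d + 1) : ℝ) ≠ 0 := by
    exact_mod_cast (Nat.choose_pos hd).ne'
  have h₃ : ((d + 1).choose (i + 1) : ℝ) ≠ 0 := by
    exact_mod_cast (Nat.choose_pos (by omega)).ne'
  rw [wt, hdeg, hcells, div_eq_div_iff (mul_ne_zero h₃ h₂) h₁]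
  norm_cast
  linarith

/-- In the complete complex, the norm of a cochain is its normalized support size. -/
theorem normC_complete [Fintype V] [DecidableEq V] {d i : ℕ} (hid : i ≤ d)
    (hd : d + 1 ≤ Fintype.card V) (f : Finset V → ZMod 2) :
    normC ((univ : Finset (Finset V)).filter fun F => F.card ≤ d + 1) d i f =
      (((univ : Finset (Finset V)).filter fun F => F.card = i + 1 ∧ f F ≠ 0).card : ℝ) /
        ((Fintype.card V).choose (i + 1) : ℝ) := by
  have hsupp : (cells ((univ : Finset (Finset V)).filter fun F => F.card ≤ d + 1) i).filter
      (fun F => f F ≠ 0) = univ.filter fun F => F.card = i + 1 ∧ f F ≠ 0 := by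
    ext F
    simp only [cells, mem_filter, mem_univ, true_and]
    exact ⟨fun h => ⟨h.1.2, h.2⟩, fun h => ⟨⟨by omega, h.1⟩, h.2⟩⟩
  rw [normC, hsupp, sum_congr rfl fun F hF => wt_complete hid hd (mem_filter.mp hF).2.1,
    sum_const, nsmul_eq_mul, mul_one_div]

/-- Contraction of the cochain `f` along the vertex `v`. -/
def contract [DecidableEq V] (v : V) (f : Finset V → ZMod 2) (T : Finset V) : ZMod 2 :=
  if v ∈ T then 0 else f (insert v T)

theorem add_dlt_contract_of_mem [DecidableEq V] {i : ℕ} {v : V} {F : Finset V}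
    (hF : F.card = i + 1) (hv : v ∈ F) (f : Finset V → ZMod 2) :
    f F + dlt i (contract v f) F = 0 := by
  have h : dlt i (contract v f) F = contract v f (F.erase v) := by
    refine sum_eq_single_of_mem _ ?_ ?_
    · rw [mem_powersetCard, card_erase_of_mem hv, hF]
      exact ⟨erase_subset _ _, rfl⟩
    · intro G hG hne
      rw [mem_powersetCard] at hG
      refine if_pos (by_contra fun hvG => hne ?_)
      refine eq_of_subset_of_card_le (subset_erase.mpr ⟨hG.1, hvG⟩) ?_
      rw [card_erase_of_mem hv, hF, hG.2]
      simp
  rw [h, contract, if_neg (notMem_erase v F), insert_erase hv, CharTwo.add_self_eq_zero]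

theorem add_dlt_contract_of_notMem [DecidableEq V] {i : ℕ} {v : V} {F : Finset V}
    (hF : F.card = i + 1) (hv : v ∉ F) (f : Finset V → ZMod 2) :
    f F + dlt i (contract v f) F = dlt (i + 1) f (insert v F) := by
  have hnot : ∀ {j : ℕ} {G : Finset V}, G ∈ F.powersetCard j → v ∉ G :=
    fun hG h => hv ((mem_powersetCard.mp hG).1 h)
  have hself : F.powersetCard (i + 1) = {F} := by rw [← hF, powersetCard_self]
  rw [dlt, dlt, powersetCard_succ_insert hv, sum_union, sum_image, hself, sum_singleton]
  · congr 1
    exact sum_congr rfl fun G hG => if_neg (hnot hG)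
  · intro G hG H hH h
    rw [← erase_insert (hnot hG), ← erase_insert (hnot hH)]
    exact congrArg (fun K => K.erase v) h
  · rw [disjoint_left]
    intro G hG hG'
    obtain ⟨H, -, rfl⟩ := mem_image.mp hG'
    exact hnot hG (mem_insert_self v H)

theorem sum_card_supp_add_dlt_contract_le [Fintype V] [DecidableEq V] (i : ℕ)
    (f : Finset V → ZMod 2) :
    ∑ v : V, ((univ : Finset (Finset V)).filter fun F =>
        F.card = i + 1 ∧ f F + dlt i (contract v f) F ≠ 0).card ≤
      (i + 2) * ((univ : Finset (Finset V)).filter fun G =>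
        G.card = i + 2 ∧ dlt (i + 1) f G ≠ 0).card := by
  set S := (univ : Finset (Finset V)).filter fun G => G.card = i + 2 ∧ dlt (i + 1) f G ≠ 0
    with hS
  have hle : ∀ v : V, ((univ : Finset (Finset V)).filter fun F =>
      F.card = i + 1 ∧ f F + dlt i (contract v f) F ≠ 0).card ≤
        (S.filter fun G => v ∈ G).card := by
    intro v
    have hnot : ∀ {F : Finset V}, F.card = i + 1 ∧ f F + dlt i (contract v f) F ≠ 0 → v ∉ F :=
      fun hF hv => hF.2 (add_dlt_contract_of_mem hF.1 hv f)
    refine card_le_card_of_injOn (fun F => insert v F) ?_ ?_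
    · intro F hF
      have hF := (mem_filter.mp (mem_coe.mp hF)).2
      have hv := hnot hF
      rw [add_dlt_contract_of_notMem hF.1 hv] at hF
      rw [mem_coe, mem_filter, hS, mem_filter, card_insert_of_notMem hv, hF.1]
      exact ⟨⟨mem_univ _, rfl, hF.2⟩, mem_insert_self v F⟩
    · intro F hF G hG h
      have hF := (mem_filter.mp (mem_coe.mp hF)).2
      have hG := (mem_filter.mp (mem_coe.mp hG)).2
      rw [← erase_insert (hnot hF), ← erase_insert (hnot hG)]
      exact congrArg (fun K => K.erase v) h
  calc _ ≤ ∑ v : V, (S.filter fun G => v ∈ G).card := sum_le_sum fun v _ => hle v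
    _ = ∑ G ∈ S, G.card := by
      simp only [card_filter]
      rw [sum_comm]
      exact sum_congr rfl fun G _ => by simp
    _ = (i + 2) * S.card := by
      rw [sum_congr rfl fun G hG => (mem_filter.mp hG).2.1, sum_const, smul_eq_mul, mul_comm]

/-- Over the complete complex, the coboundary is at least as heavy as the cochain's coset. -/
theorem distB_complete_le [Fintype V] [DecidableEq V] {d i : ℕ} (hi : i < d)
    (hd : d + 1 ≤ Fintype.card V) (f : Finset V → ZMod 2) :
    distB ((univ : Finset (Finset V)).filter fun F => F.card ≤ d + 1) d i f ≤
      normC ((univ : Finset (Finset V)).filter fun F => F.card ≤ d + 1) d (i + 1)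
        (dlt (i + 1) f) := by
  set X := (univ : Finset (Finset V)).filter fun F => F.card ≤ d + 1 with hX
  set n := Fintype.card V with hn
  have hnorm : ∀ v : V, distB X d i f ≤
      (((univ : Finset (Finset V)).filter fun F =>
        F.card = i + 1 ∧ f F + dlt i (contract v f) F ≠ 0).card : ℝ) / (n.choose (i + 1) : ℝ) := by
    intro v
    refine csInf_le ⟨0, ?_⟩ ⟨contract v f, (normC_complete hi.le hd _).symm⟩
    rintro r ⟨g, rfl⟩
    rw [normC_complete hi.le hd]
    positivity
  have hsum := sum_le_sum fun v (_ : v ∈ (univ : Finset V)) => hnorm v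
  rw [sum_const, card_univ, nsmul_eq_mul, ← sum_div, ← Nat.cast_sum] at hsum
  have hcount := sum_card_supp_add_dlt_contract_le i f
  rw [normC_complete (show i + 1 ≤ d by omega) hd]
  set A := ((univ : Finset (Finset V)).filter fun G =>
    G.card = i + 1 + 1 ∧ dlt (i + 1) f G ≠ 0).card with hA
  have hchoose : n.choose (i + 2) * (i + 2) ≤ n.choose (i + 1) * n := by
    rw [Nat.choose_succ_right_eq n (i + 1)]
    exact Nat.mul_le_mul_left _ (Nat.sub_le _ _)
  have h₁ : 0 < (n.choose (i + 1) : ℝ) := by exact_mod_cast Nat.choose_pos (by omega)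
  have h₂ : 0 < (n.choose (i + 1 + 1) : ℝ) := by exact_mod_cast Nat.choose_pos (by omega)
  have hn₀ : 0 < (n : ℝ) := by exact_mod_cast (show 0 < n by omega)
  rw [le_div_iff₀ h₁] at hsum
  have hcount' : (n : ℝ) * distB X d i f * n.choose (i + 1) ≤ (i + 2) * A := by
    refine hsum.trans ?_
    exact_mod_cast hcount
  have hchoose' : (n.choose (i + 1 + 1) : ℝ) * (i + 2) ≤ n.choose (i + 1) * n := by
    exact_mod_cast hchoose
  rw [le_div_iff₀ h₂]
  refine le_of_mul_le_mul_right ?_ (mul_pos h₁ hn₀)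
  calc distB X d i f * n.choose (i + 1 + 1) * (n.choose (i + 1) * n)
      = n.choose (i + 1 + 1) * (n * distB X d i f * n.choose (i + 1)) := by ring
    _ ≤ n.choose (i + 1 + 1) * ((i + 2) * A) := by gcongr
    _ = A * (n.choose (i + 1 + 1) * (i + 2)) := by ring
    _ ≤ A * (n.choose (i + 1) * n) := by gcongr

theorem distB_complete_pos [Fintype V] [DecidableEq V] {d i : ℕ} (hi : i ≤ d)
    (hd : d + 1 ≤ Fintype.card V) {f : Finset V → ZMod 2}
    (hf : ¬ MemB ((univ : Finset (Finset V)).filter fun F => F.card ≤ d + 1) i f) :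
    0 < distB ((univ : Finset (Finset V)).filter fun F => F.card ≤ d + 1) d i f := by
  have hc : 0 < ((Fintype.card V).choose (i + 1) : ℝ) := by
    exact_mod_cast Nat.choose_pos (by omega)
  refine (one_div_pos.mpr hc).trans_le (le_csInf ⟨_, 0, rfl⟩ ?_)
  rintro r ⟨g, rfl⟩
  rw [normC_complete hi hd]
  gcongr
  rw [Nat.one_le_cast, Nat.one_le_iff_ne_zero, Ne, card_eq_zero]
  refine fun h => hf ⟨g, fun F hF => ?_⟩
  have hF' : F.card = i + 1 := (mem_filter.mp hF).2
  by_contra hne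
  have := filter_eq_empty_iff.mp h (mem_univ F)
  exact this ⟨hF', fun h₀ => hne (CharTwo.add_eq_zero.mp h₀)⟩

/-- for every `d ≥ 1`, `0 ≤ i ≤ d-1` and `ε > 0` there is `N` such that
for all `n ≥ N` the complete `d`-dimensional complex on `n` vertices satisfies
`𝓱ᵢ(Δₙ^{(d)}) ≥ 1 - ε`, i.e. `‖δᵢ f‖/‖[f]‖ ≥ 1 - ε` for every `f ∈ Cⁱ \ Bⁱ`. -/
theorem complete_complex_coboundary_expansion (d i : ℕ) (hd : 1 ≤ d) (hi : i < d)
    (ε : ℝ) (hε : 0 < ε) :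
    ∃ N : ℕ, ∀ n : ℕ, N ≤ n →
      ∀ f : Finset (Fin n) → ZMod 2,
        ¬ MemB ((Finset.univ : Finset (Finset (Fin n))).filter fun F => F.card ≤ d + 1) i f →
        1 - ε ≤
          normC ((Finset.univ : Finset (Finset (Fin n))).filter fun F => F.card ≤ d + 1)
              d (i + 1) (dlt (i + 1) f) /
            distB ((Finset.univ : Finset (Finset (Fin n))).filter fun F => F.card ≤ d + 1)
              d i f := by
  refine ⟨d + 1, fun n hn f hf => ?_⟩
  have hcard : d + 1 ≤ Fintype.card (Fin n) := by rwa [Fintype.card_fin]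
  rw [le_div_iff₀ (distB_complete_pos hi.le hcard hf)]
  have hpos := distB_complete_pos hi.le hcard hf
  have hle := distB_complete_le hi hcard f
  nlinarith
end

section
/- (Gromov) For every d ≥ 1 and every ε > 0 there exists ε' > 0 such that every finite pure d-dimensional simplicial complex X with 𝓱(X) ≥ ε is an ε'-topological expander. -/
open Finset
open scoped Classical

variable {V : Type}

/-- The geometric realization of `X`, as a subset of `ℝ^V`. -/
def realization [Fintype V] [DecidableEq V] (X : Finset (Finset V)) : Set (V → ℝ) :=
  {x | (∀ v, 0 ≤ x v) ∧ (∑ v, x v) = 1 ∧ (Finset.univ.filter fun v => x v ≠ 0) ∈ X}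

/-- `|σ|`: the points of the geometric realization supported on the face `σ`. -/
def faceReal [Fintype V] [DecidableEq V] (X : Finset (Finset V)) (σ : Finset V) :
    Set (V → ℝ) :=
  {x ∈ realization X | ∀ v, x v ≠ 0 → v ∈ σ}

section ListCochains

variable {P : Type*}

/-- The coboundary of a mod 2 cochain on ordered tuples of points (augmented by the empty tuple):
the sum of the values at all tuples obtained by deleting one entry. -/
def listCob : (List P → ZMod 2) → List P → ZMod 2
  | _, [] => 0
  | β, x :: l => β l + listCob (fun m => β (x :: m)) l

/-- The dual of the prism operator between the simplicial maps induced by `g₀` and `g₁`. -/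
def prism (g₀ g₁ : P → P) : (List P → ZMod 2) → List P → ZMod 2
  | _, [] => 0
  | β, x :: l => β (g₀ x :: g₁ x :: l.map g₁) + prism g₀ g₁ (fun m => β (g₀ x :: m)) l

theorem listCob_add (β γ : List P → ZMod 2) (l : List P) :
    listCob (fun m => β m + γ m) l = listCob β l + listCob γ l := by
  induction l generalizing β γ with
  | nil => simp [listCob]
  | cons x l ih => simp only [listCob, ih]; ring

theorem listCob_zero (l : List P) : listCob (fun _ => 0) l = 0 := by
  induction l with
  | nil => rfl
  | cons x l ih => simp [listCob, ih]

theorem listCob_const_mul (a : ZMod 2) (β : List P → ZMod 2) (l : List P) :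
    listCob (fun m => a * β m) l = a * listCob β l := by
  induction l generalizing β with
  | nil => simp [listCob]
  | cons x l ih => simp only [listCob, ih]; ring

theorem listCob_sum {ι : Type*} (s : Finset ι) (β : ι → List P → ZMod 2) (l : List P) :
    listCob (fun m => ∑ i ∈ s, β i m) l = ∑ i ∈ s, listCob (β i) l := by
  induction s using Finset.induction_on with
  | empty => simp [listCob_zero]
  | insert a s ha ih => simp only [Finset.sum_insert ha, listCob_add, ih]

theorem listCob_map (g : P → P) (β : List P → ZMod 2) (l : List P) :
    listCob (fun m => β (m.map g)) l = listCob β (l.map g) := by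
  induction l generalizing β with
  | nil => simp [listCob]
  | cons x l ih =>
    simp only [listCob, List.map_cons]
    rw [ih (fun m => β (g x :: m))]

theorem prism_add (g₀ g₁ : P → P) (β γ : List P → ZMod 2) (l : List P) :
    prism g₀ g₁ (fun m => β m + γ m) l = prism g₀ g₁ β l + prism g₀ g₁ γ l := by
  induction l generalizing β γ with
  | nil => simp [prism]
  | cons x l ih => simp only [prism, ih]; ring

theorem listCob_prism (g₀ g₁ : P → P) (β : List P → ZMod 2) (l : List P) :
    listCob (prism g₀ g₁ β) l + prism g₀ g₁ (listCob β) l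
      = β (l.map g₀) + β (l.map g₁) := by
  induction l generalizing β with
  | nil => simp [listCob, prism, CharTwo.add_self_eq_zero]
  | cons x l ih =>
    have h := ih (fun m => β (g₀ x :: m))
    simp only [listCob, prism, List.map_cons, listCob_add, prism_add]
    rw [listCob_map g₁ (fun m => β (g₀ x :: g₁ x :: m))]
    linear_combination h + CharTwo.add_self_eq_zero (prism g₀ g₁ β l)
      + CharTwo.add_self_eq_zero (listCob (fun m => β (g₀ x :: g₁ x :: m)) (l.map g₁))
      + CharTwo.add_self_eq_zero (β (g₀ x :: l.map g₁))

theorem exists_of_prism_ne_zero (g₀ g₁ : P → P) (β : List P → ZMod 2) (l : List P)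
    (h : prism g₀ g₁ β l ≠ 0) :
    ∃ m, β m ≠ 0 ∧ ∀ y ∈ m, ∃ x ∈ l, y = g₀ x ∨ y = g₁ x := by
  induction l generalizing β with
  | nil => exact absurd rfl h
  | cons x l ih =>
    by_cases h0 : β (g₀ x :: g₁ x :: l.map g₁) = 0
    · have h1 : prism g₀ g₁ (fun m => β (g₀ x :: m)) l ≠ 0 := by
        simpa [prism, h0] using h
      obtain ⟨m, hm, hm'⟩ := ih _ h1
      refine ⟨g₀ x :: m, hm, ?_⟩
      grind
    · exact ⟨_, h0, by grind⟩

end ListCochains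

section Contraction

variable {E : Type*} [NormedAddCommGroup E] [NormedSpace ℝ E]

/-- The point reached from `x` after `t` of the `N` equal steps towards `p`. -/
noncomputable def stepTo (N : ℕ) (p : E) (t : ℕ) (x : E) : E :=
  AffineMap.lineMap x p ((t : ℝ) / N)

/-- The dual of the operator contracting tuples of points to `p` in `N` equal steps. -/
noncomputable def contraction (N : ℕ) (p : E) (β : List E → ZMod 2) (l : List E) : ZMod 2 :=
  ∑ t ∈ Finset.range N, prism (stepTo N p t) (stepTo N p (t + 1)) β l
    + β (p :: l.map (stepTo N p N))

theorem contraction_add (N : ℕ) (p : E) (β γ : List E → ZMod 2) :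
    contraction N p (fun m => β m + γ m)
      = fun l => contraction N p β l + contraction N p γ l := by
  funext l
  simp only [contraction, prism_add, Finset.sum_add_distrib]
  ring

theorem contraction_listCob (N : ℕ) (p : E) (β : List E → ZMod 2) :
    contraction N p (listCob β) = fun l => β l + listCob (contraction N p β) l := by
  funext l
  have telescope : ∀ n : ℕ, ∑ t ∈ Finset.range n, (β (l.map (stepTo N p t))
      + β (l.map (stepTo N p (t + 1)))) = β l + β (l.map (stepTo N p n)) := by
    intro n
    induction n with
    | zero =>
      have : stepTo N p 0 = id := by funext x; simp [stepTo]
      simp [this, CharTwo.add_self_eq_zero]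
    | succ n ih =>
      rw [Finset.sum_range_succ, ih]
      linear_combination CharTwo.add_self_eq_zero (β (l.map (stepTo N p n)))
  have h := telescope N
  simp only [← listCob_prism, Finset.sum_add_distrib] at h
  have hc : listCob (contraction N p β) l
      = ∑ t ∈ Finset.range N, listCob (prism (stepTo N p t) (stepTo N p (t + 1)) β) l
        + listCob (fun m => β (p :: m)) (l.map (stepTo N p N)) := by
    rw [← listCob_sum, ← listCob_map (stepTo N p N) (fun m => β (p :: m)), ← listCob_add]
    rfl
  rw [hc]
  simp only [contraction, listCob]
  linear_combination h + CharTwo.add_self_eq_zero (β (l.map (stepTo N p N)))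
    - CharTwo.add_self_eq_zero
      (∑ t ∈ Finset.range N, listCob (prism (stepTo N p t) (stepTo N p (t + 1)) β) l)

theorem dist_lineMap_lineMap_le {x y p : E} {a b : ℝ} (ha : 0 ≤ a) (ha' : a ≤ 1) :
    dist (AffineMap.lineMap x p a) (AffineMap.lineMap y p b : E)
      ≤ dist x y + |a - b| * dist y p := by
  have h : (AffineMap.lineMap x p a : E) - AffineMap.lineMap y p b
      = (1 - a) • (x - y) + (b - a) • (y - p) := by
    simp only [AffineMap.lineMap_apply_module]
    module
  rw [dist_eq_norm, h]
  refine (norm_add_le _ _).trans ?_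
  rw [norm_smul, norm_smul, dist_eq_norm, dist_eq_norm, Real.norm_eq_abs, Real.norm_eq_abs,
    abs_sub_comm b a, abs_of_nonneg (by linarith : 0 ≤ 1 - a)]
  nlinarith [norm_nonneg (x - y)]

/-- The tuples of points of `S` at pairwise distance at most `δ`. -/
def IsSmallTuple (S : Set E) (δ : ℝ) (l : List E) : Prop :=
  (∀ x ∈ l, x ∈ S) ∧ ∀ x ∈ l, ∀ y ∈ l, dist x y ≤ δ

theorem exists_of_contraction_ne_zero {N : ℕ} (hN : 0 < N) {p : E} {S : Set E}
    (hS : Convex ℝ S) (hp : p ∈ S) (hdiam : ∀ x ∈ S, dist x p ≤ 1) {δ : ℝ} (hδ : 0 ≤ δ)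
    (β : List E → ZMod 2) (l : List E) (hl : IsSmallTuple S δ l)
    (h : contraction N p β l ≠ 0) :
    ∃ m, β m ≠ 0 ∧ IsSmallTuple S (δ + 1 / N) m := by
  have hN' : (0 : ℝ) < N := by exact_mod_cast hN
  by_cases h0 : β (p :: l.map (stepTo N p N)) = 0
  · have h1 : ∑ t ∈ Finset.range N, prism (stepTo N p t) (stepTo N p (t + 1)) β l ≠ 0 := by
      simpa [contraction, h0] using h
    obtain ⟨t, ht, ht'⟩ := Finset.exists_ne_zero_of_sum_ne_zero h1
    obtain ⟨m, hm, hm'⟩ := exists_of_prism_ne_zero _ _ _ _ ht'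
    have htN : t + 1 ≤ N := Finset.mem_range.1 ht
    have key : ∀ y ∈ m, ∃ x ∈ l, ∃ s : ℕ, t ≤ s ∧ s ≤ t + 1 ∧ y = stepTo N p s x := by
      intro y hy
      obtain ⟨x, hx, rfl | rfl⟩ := hm' y hy
      · exact ⟨x, hx, t, le_rfl, by omega, rfl⟩
      · exact ⟨x, hx, t + 1, by omega, le_rfl, rfl⟩
    have frac : ∀ s : ℕ, s ≤ t + 1 → 0 ≤ (s : ℝ) / N ∧ (s : ℝ) / N ≤ 1 := by
      intro s hs
      refine ⟨by positivity, (div_le_one hN').2 ?_⟩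
      exact_mod_cast hs.trans htN
    refine ⟨m, hm, ?_, ?_⟩
    · intro y hy
      obtain ⟨x, hx, s, -, hs, rfl⟩ := key y hy
      exact hS.lineMap_mem (hl.1 x hx) hp (frac s hs)
    · intro y hy y' hy'
      obtain ⟨x, hx, s, hs, hs', rfl⟩ := key y hy
      obtain ⟨x', hx', s', hr, hr', rfl⟩ := key y' hy'
      refine (dist_lineMap_lineMap_le (frac s hs').1 (frac s hs').2).trans ?_
      have habs : |(s : ℝ) / N - s' / N| ≤ 1 / N := by
        rw [← sub_div, abs_div, abs_of_pos hN']
        gcongr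
        have h1 : (t : ℝ) ≤ s := by exact_mod_cast hs
        have h2 : (s : ℝ) ≤ t + 1 := by exact_mod_cast hs'
        have h3 : (t : ℝ) ≤ s' := by exact_mod_cast hr
        have h4 : (s' : ℝ) ≤ t + 1 := by exact_mod_cast hr'
        rw [abs_le]; constructor <;> linarith
      have h5 := hl.2 x hx x' hx'
      have h6 := hdiam x' (hl.1 x' hx')
      nlinarith [abs_nonneg ((s : ℝ) / N - s' / N), dist_nonneg (x := x') (y := p)]
  · have hy : ∀ y ∈ p :: l.map (stepTo N p N), y = p := by
      have : ∀ x, stepTo N p N x = p := by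
        intro x
        simp [stepTo, div_self hN'.ne']
      simp only [List.mem_cons, List.mem_map, this]
      grind
    refine ⟨_, h0, fun y hy' => (hy y hy') ▸ hp, fun y hy' z hz => ?_⟩
    rw [hy y hy', hy z hz, dist_self]
    positivity

end Contraction

section Subdivision

theorem sum_sum_erase_eq_zero {ι : Type*} [DecidableEq ι] (s : Finset ι) (a : ι → ι → ZMod 2)
    (ha : ∀ i j, a i j = a j i) : ∑ i ∈ s, ∑ j ∈ s.erase i, a i j = 0 := by
  induction s using Finset.induction_on with
  | empty => simp
  | insert k s hk ih =>
    rw [Finset.sum_insert hk, Finset.erase_insert hk]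
    have : ∀ i ∈ s, ∑ j ∈ (insert k s).erase i, a i j = a k i + ∑ j ∈ s.erase i, a i j := by
      intro i hi
      have hik : k ≠ i := fun h => hk (h ▸ hi)
      rw [Finset.erase_insert_of_ne hik, Finset.sum_insert (by simp [hk]), ha i k]
    rw [Finset.sum_congr rfl this, Finset.sum_add_distrib, ih, add_zero,
      CharTwo.add_self_eq_zero]

variable {E : Type*} [NormedAddCommGroup E] [NormedSpace ℝ E] [DecidableEq V]

/-- The mod 2 chain of small tuples subdividing the simplex `σ`, as a functional on cochains:
the boundary chain is contracted in `N` steps to the point `p σ`. -/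
noncomputable def subdivision (N : ℕ) (p : Finset V → E) (σ : Finset V)
    (β : List E → ZMod 2) : ZMod 2 :=
  if σ = ∅ then β []
  else ∑ v ∈ σ.attach, subdivision N p (σ.erase v) (contraction N (p σ) β)
termination_by σ.card
decreasing_by exact Finset.card_erase_lt_of_mem v.2

theorem subdivision_empty (N : ℕ) (p : Finset V → E) (β : List E → ZMod 2) :
    subdivision N p ∅ β = β [] := by
  rw [subdivision, if_pos rfl]

theorem subdivision_eq_sum (N : ℕ) (p : Finset V → E) {σ : Finset V} (hσ : σ ≠ ∅)
    (β : List E → ZMod 2) :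
    subdivision N p σ β = ∑ v ∈ σ, subdivision N p (σ.erase v) (contraction N (p σ) β) := by
  rw [subdivision, if_neg hσ,
    Finset.sum_attach σ fun v => subdivision N p (σ.erase v) (contraction N (p σ) β)]

theorem subdivision_add (N : ℕ) (p : Finset V → E) (σ : Finset V) (β γ : List E → ZMod 2) :
    subdivision N p σ (fun l => β l + γ l) = subdivision N p σ β + subdivision N p σ γ := by
  induction σ using Finset.strongInduction generalizing β γ with
  | H σ ih =>
    rcases eq_or_ne σ ∅ with rfl | hσ
    · simp only [subdivision_empty]
    · simp only [subdivision_eq_sum N p hσ]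
      rw [← Finset.sum_add_distrib]
      refine Finset.sum_congr rfl fun v hv => ?_
      rw [contraction_add, ih _ (Finset.erase_ssubset hv)]

theorem subdivision_zero (N : ℕ) (p : Finset V → E) (σ : Finset V) :
    subdivision N p σ (fun _ => 0) = 0 := by
  have h := subdivision_add N p σ (fun _ => 0) (fun _ => 0)
  simpa using h

theorem subdivision_sum {ι : Type*} (N : ℕ) (p : Finset V → E) (σ : Finset V) (s : Finset ι)
    (β : ι → List E → ZMod 2) :
    subdivision N p σ (fun l => ∑ i ∈ s, β i l) = ∑ i ∈ s, subdivision N p σ (β i) := by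
  induction s using Finset.induction_on with
  | empty => simp [subdivision_zero]
  | insert a s ha ih => simp only [Finset.sum_insert ha, subdivision_add, ih]

theorem subdivision_listCob (N : ℕ) (p : Finset V → E) (σ : Finset V) (β : List E → ZMod 2) :
    subdivision N p σ (listCob β) = ∑ v ∈ σ, subdivision N p (σ.erase v) β := by
  induction σ using Finset.strongInduction generalizing β with
  | H σ ih =>
    rcases eq_or_ne σ ∅ with rfl | hσ
    · simp [subdivision_empty, listCob]
    · rw [subdivision_eq_sum N p hσ]
      simp only [contraction_listCob, subdivision_add]
      rw [Finset.sum_add_distrib]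
      have h : ∑ v ∈ σ, subdivision N p (σ.erase v) (listCob (contraction N (p σ) β)) = 0 := by
        rw [Finset.sum_congr rfl fun v hv => ih _ (Finset.erase_ssubset hv) _]
        exact sum_sum_erase_eq_zero σ
          (fun v w => subdivision N p ((σ.erase v).erase w) (contraction N (p σ) β))
          fun v w => by rw [Finset.erase_right_comm]
      exact (congrArg (_ + ·) h).trans (add_zero _)

theorem subdivision_singleton (N : ℕ) (p : Finset V → E) (v : V) (β : List E → ZMod 2) :
    subdivision N p {v} β = β [p {v}] := by
  rw [subdivision_eq_sum N p (Finset.singleton_ne_empty v)]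
  simp [subdivision_empty, contraction, prism]

theorem exists_of_subdivision_ne_zero {N : ℕ} (hN : 0 < N) (p : Finset V → E)
    (S : Finset V → Set E) (hmono : ∀ σ τ, σ ⊆ τ → S σ ⊆ S τ) (hconv : ∀ σ, Convex ℝ (S σ))
    (hp : ∀ σ, σ ≠ ∅ → p σ ∈ S σ) (hdiam : ∀ σ, ∀ x ∈ S σ, ∀ y ∈ S σ, dist x y ≤ 1)
    (σ : Finset V) (β : List E → ZMod 2) (h : subdivision N p σ β ≠ 0) :
    ∃ l, β l ≠ 0 ∧ IsSmallTuple (S σ) ((σ.card : ℝ) / N) l := by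
  induction σ using Finset.strongInduction generalizing β with
  | H σ ih =>
    rcases eq_or_ne σ ∅ with rfl | hσ
    · rw [subdivision_empty] at h
      exact ⟨[], h, by simp [IsSmallTuple]⟩
    · rw [subdivision_eq_sum N p hσ] at h
      obtain ⟨v, hv, hv'⟩ := Finset.exists_ne_zero_of_sum_ne_zero h
      obtain ⟨l, hl, hsmall⟩ := ih _ (Finset.erase_ssubset hv) _ hv'
      obtain ⟨m, hm, hm'⟩ := exists_of_contraction_ne_zero hN (hconv σ) (hp σ hσ)
        (fun x hx => hdiam σ x hx _ (hp σ hσ)) (δ := ((σ.erase v).card : ℝ) / N)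
        (by positivity) β l
        ⟨fun x hx => hmono _ _ (Finset.erase_subset v σ) (hsmall.1 x hx), hsmall.2⟩ hl
      refine ⟨m, hm, ?_⟩
      have hcard : ((σ.erase v).card : ℝ) + 1 = σ.card := by
        exact_mod_cast Finset.card_erase_add_one hv
      rwa [← add_div, hcard] at hm'

end Subdivision

section GridCochains

variable {P : Type*} {n : ℕ}

/-- The cup product of the coboundary of the 0-cochain `u` with the cochain `β`. -/
def edgeCup (u : P → ZMod 2) (β : List P → ZMod 2) : List P → ZMod 2
  | x :: y :: l => (u x + u y) * β (y :: l)
  | _ => 0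

/-- The cup product of the 0-cochain `u` with the cochain `β`. -/
def vertexCup (u : P → ZMod 2) (β : List P → ZMod 2) : List P → ZMod 2
  | x :: l => u x * β (x :: l)
  | [] => 0

/-- The constant 0-cochain `1`. -/
def unitCochain : List P → ZMod 2
  | [_] => 1
  | _ => 0

theorem listCob_unitCochain (l : List P) : listCob unitCochain l = 0 := by
  match l with
  | [] => rfl
  | [x] => rfl
  | [x, y] => exact CharTwo.add_self_eq_zero _
  | x :: y :: z :: l =>
    simp only [listCob, unitCochain, listCob_zero, zero_add]

theorem listCob_vertexCup (u : P → ZMod 2) (β : List P → ZMod 2) (h : β [] = 0) (l : List P) :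
    listCob (vertexCup u β) l = edgeCup u β l + vertexCup u (listCob β) l := by
  match l with
  | [] => simp [listCob, edgeCup, vertexCup]
  | [x] => simp [listCob, edgeCup, vertexCup, h]
  | x :: y :: l =>
    have hx : (fun m => vertexCup u β (x :: m)) = fun m => u x * β (x :: m) := rfl
    rw [listCob, hx, listCob_const_mul]
    simp only [edgeCup, vertexCup]
    rw [listCob.eq_2 β x]
    linear_combination - CharTwo.add_self_eq_zero (u x * β (y :: l))

theorem listCob_edgeCup (u : P → ZMod 2) (β : List P → ZMod 2) (h : β [] = 0) (l : List P) :
    listCob (edgeCup u β) l = edgeCup u (listCob β) l := by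
  match l with
  | [] => rfl
  | [x] => rfl
  | [x, y] => simp [listCob, edgeCup, h]
  | x :: y :: z :: l =>
    have hxy : (fun m => edgeCup u β (x :: y :: m)) = fun m => (u x + u y) * β (y :: m) := rfl
    rw [listCob, listCob, hxy, listCob_const_mul]
    simp only [edgeCup]
    rw [listCob.eq_2 β y]
    linear_combination CharTwo.add_self_eq_zero (u z * β (z :: l))

/-- The grid cell of `ℤⁿ` with base point `q` and directions `S` as a cochain on tuples of
points, with `u m a` the indicator of the half space below `a` in the coordinate `m`. The list
`L` holds the coordinates taken into account. -/
def gridCochain (u : Fin n → ℤ → P → ZMod 2) (q : Fin n → ℤ) (S : Finset (Fin n)) :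
    List (Fin n) → List P → ZMod 2
  | [] => unitCochain
  | m :: L =>
    if m ∈ S then vertexCup (fun x => u m (q m) x + u m (q m + 1) x) (gridCochain u q S L)
    else edgeCup (u m (q m)) (gridCochain u q S L)

theorem gridCochain_nil (u : Fin n → ℤ → P → ZMod 2) (q : Fin n → ℤ) (S : Finset (Fin n))
    (L : List (Fin n)) : gridCochain u q S L [] = 0 := by
  cases L with
  | nil => rfl
  | cons m L => rw [gridCochain]; split_ifs <;> rfl

theorem gridCochain_congr (u : Fin n → ℤ → P → ZMod 2) {q q' : Fin n → ℤ}
    {S S' : Finset (Fin n)} (L : List (Fin n)) (hq : ∀ m ∈ L, q m = q' m)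
    (hS : ∀ m ∈ L, m ∈ S ↔ m ∈ S') : gridCochain u q S L = gridCochain u q' S' L := by
  induction L with
  | nil => rfl
  | cons m L ih =>
    rw [gridCochain, gridCochain, ih (fun k hk => hq k (by simp [hk]))
      (fun k hk => hS k (by simp [hk])), hq m (by simp)]
    simp only [hS m (by simp)]

theorem edgeCup_add_left (u v : P → ZMod 2) (β : List P → ZMod 2) (l : List P) :
    edgeCup (fun x => u x + v x) β l = edgeCup u β l + edgeCup v β l := by
  match l with
  | [] => simp [edgeCup]
  | [x] => simp [edgeCup]
  | x :: y :: l => simp only [edgeCup]; ring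

theorem edgeCup_sum {ι : Type*} (u : P → ZMod 2) (s : Finset ι) (β : ι → List P → ZMod 2)
    (l : List P) : edgeCup u (fun m => ∑ i ∈ s, β i m) l = ∑ i ∈ s, edgeCup u (β i) l := by
  match l with
  | [] => simp [edgeCup]
  | [x] => simp [edgeCup]
  | x :: y :: l => simp only [edgeCup, Finset.mul_sum]

theorem vertexCup_sum {ι : Type*} (u : P → ZMod 2) (s : Finset ι) (β : ι → List P → ZMod 2)
    (l : List P) : vertexCup u (fun m => ∑ i ∈ s, β i m) l = ∑ i ∈ s, vertexCup u (β i) l := by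
  match l with
  | [] => simp [vertexCup]
  | x :: l => simp only [vertexCup, Finset.mul_sum]

theorem edgeCup_add (u : P → ZMod 2) (β γ : List P → ZMod 2) (l : List P) :
    edgeCup u (fun m => β m + γ m) l = edgeCup u β l + edgeCup u γ l := by
  match l with
  | [] => simp [edgeCup]
  | [x] => simp [edgeCup]
  | x :: y :: l => simp only [edgeCup]; ring

theorem vertexCup_add (u : P → ZMod 2) (β γ : List P → ZMod 2) (l : List P) :
    vertexCup u (fun m => β m + γ m) l = vertexCup u β l + vertexCup u γ l := by
  match l with
  | [] => simp [vertexCup]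
  | x :: l => simp only [vertexCup]; ring

theorem listCob_gridCochain (u : Fin n → ℤ → P → ZMod 2) (q : Fin n → ℤ)
    (S : Finset (Fin n)) (L : List (Fin n)) (hL : L.Nodup) :
    listCob (gridCochain u q S L) = fun l => ∑ m ∈ S with m ∈ L,
      (gridCochain u q (S.erase m) L l + gridCochain u (q + Pi.single m 1) (S.erase m) L l) := by
  induction L with
  | nil => funext l; simp [gridCochain, listCob_unitCochain]
  | cons k L ih =>
    obtain ⟨hk, hL⟩ := List.nodup_cons.1 hL
    have ih := ih hL
    have hne : ∀ m ∈ S.filter (· ∈ L), k ≠ m := by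
      intro m hm h
      exact hk (h ▸ (Finset.mem_filter.1 hm).2)
    funext l
    by_cases hkS : k ∈ S
    · have hfilter : S.filter (· ∈ k :: L) = insert k (S.filter (· ∈ L)) := by
        ext m; simp only [Finset.mem_filter, Finset.mem_insert, List.mem_cons]; grind
      rw [hfilter, Finset.sum_insert (by simp [hk]), gridCochain, if_pos hkS,
        listCob_vertexCup _ _ (gridCochain_nil u q S L), edgeCup_add_left, ih, vertexCup_sum]
      congr 1
      · rw [gridCochain, gridCochain, if_neg (by simp), if_neg (by simp),
          gridCochain_congr u (q := q) (q' := q) (S := S.erase k) (S' := S) L (fun _ _ => rfl)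
            (by grind),
          gridCochain_congr u (q := q + Pi.single k 1) (q' := q) (S := S.erase k) (S' := S) L
            (fun m hm => by
              have : m ≠ k := fun h => hk (h ▸ hm)
              simp [this]) (by grind)]
        simp
      · refine Finset.sum_congr rfl fun m hm => ?_
        have hkm := hne m hm
        rw [vertexCup_add, gridCochain, gridCochain, if_pos (by grind), if_pos (by grind)]
        simp [hkm]
    · have hfilter : S.filter (· ∈ k :: L) = S.filter (· ∈ L) := by
        ext m; simp only [Finset.mem_filter, List.mem_cons]; grind
      rw [hfilter, gridCochain, if_neg hkS, listCob_edgeCup _ _ (gridCochain_nil u q S L), ih,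
        edgeCup_sum]
      refine Finset.sum_congr rfl fun m hm => ?_
      have hkm := hne m hm
      rw [edgeCup_add, gridCochain, gridCochain, if_neg (by grind), if_neg (by grind)]
      simp [hkm]

theorem ne_nil_of_gridCochain_ne_zero {u : Fin n → ℤ → P → ZMod 2} {q : Fin n → ℤ}
    {S : Finset (Fin n)} {L : List (Fin n)} {l : List P} (h : gridCochain u q S L l ≠ 0) :
    l ≠ [] := by
  rintro rfl
  exact h (gridCochain_nil u q S L)

theorem exists_of_gridCochain_ne_zero {u : Fin n → ℤ → P → ZMod 2} {q : Fin n → ℤ}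
    {S : Finset (Fin n)} {L : List (Fin n)} {l : List P} (h : gridCochain u q S L l ≠ 0)
    {m : Fin n} (hm : m ∈ L) :
    ∃ x ∈ l, ∃ y ∈ l, u m (q m) x ≠ u m (q m) y ∨ u m (q m) x ≠ u m (q m + 1) x := by
  induction L generalizing l with
  | nil => simp at hm
  | cons k L ih =>
    rw [gridCochain] at h
    split_ifs at h with hk
    · match l, h with
      | x :: l, h =>
        simp only [vertexCup] at h
        rcases List.mem_cons.1 hm with rfl | hm
        · refine ⟨x, by simp, x, by simp, Or.inr fun h' => left_ne_zero_of_mul h ?_⟩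
          rw [h', CharTwo.add_self_eq_zero]
        · exact ih (right_ne_zero_of_mul h) hm
    · match l, h with
      | [], h => simp [edgeCup] at h
      | [x], h => simp [edgeCup] at h
      | x :: y :: l, h =>
        simp only [edgeCup] at h
        rcases List.mem_cons.1 hm with rfl | hm
        · refine ⟨x, by simp, y, by simp, Or.inl fun h' => left_ne_zero_of_mul h ?_⟩
          rw [h', CharTwo.add_self_eq_zero]
        · obtain ⟨a, ha, b, hb, hab⟩ := ih (right_ne_zero_of_mul h) hm
          exact ⟨a, by simp [List.mem_cons.1 ha], b, by simp [List.mem_cons.1 hb], hab⟩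

theorem gridCochain_univ_singleton (u : Fin n → ℤ → P → ZMod 2) (q : Fin n → ℤ)
    (L : List (Fin n)) (x : P) :
    gridCochain u q Finset.univ L [x]
      = (L.map fun m => u m (q m) x + u m (q m + 1) x).prod := by
  induction L with
  | nil => rfl
  | cons m L ih => simp [gridCochain, vertexCup, ih]

end GridCochains

section Expansion

variable [DecidableEq V] {X : Finset (Finset V)} {d : ℕ}

theorem mem_cells {i : ℕ} {F : Finset V} : F ∈ cells X i ↔ F ∈ X ∧ F.card = i + 1 :=
  Finset.mem_filter

theorem dlt_eq_sum_erase {j : ℕ} (g : Finset V → ZMod 2) {F : Finset V} (hF : F.card = j + 1) :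
    dlt j g F = ∑ v ∈ F, g (F.erase v) := by
  symm
  refine Finset.sum_bij (fun v _ => F.erase v) ?_ ?_ ?_ (fun _ _ => rfl)
  · intro v hv
    rw [Finset.mem_powersetCard, Finset.card_erase_of_mem hv, hF]
    exact ⟨Finset.erase_subset v F, rfl⟩
  · intro v hv w hw h
    by_contra hvw
    have : v ∈ F.erase w := Finset.mem_erase.2 ⟨hvw, hv⟩
    rw [← h] at this
    simp at this
  · intro G hG
    obtain ⟨hGF, hG⟩ := Finset.mem_powersetCard.1 hG
    have h1 : (F \ G).card = 1 := by rw [Finset.card_sdiff_of_subset hGF]; omega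
    obtain ⟨v, hv⟩ := Finset.card_eq_one.1 h1
    have hvF : v ∈ F \ G := by simp [hv]
    refine ⟨v, (Finset.mem_sdiff.1 hvF).1, ?_⟩
    rw [Finset.erase_eq, ← hv, Finset.sdiff_sdiff_eq_self hGF]

theorem dlt_add (j : ℕ) (f g : Finset V → ZMod 2) (F : Finset V) :
    dlt j (fun G => f G + g G) F = dlt j f F + dlt j g F :=
  Finset.sum_add_distrib

theorem dlt_sum {ι : Type*} (j : ℕ) (s : Finset ι) (f : ι → Finset V → ZMod 2)
    (F : Finset V) : dlt j (fun G => ∑ a ∈ s, f a G) F = ∑ a ∈ s, dlt j (f a) F :=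
  Finset.sum_comm

theorem dlt_dlt {j : ℕ} (g : Finset V → ZMod 2) {F : Finset V} (hF : F.card = j + 2) :
    dlt (j + 1) (dlt j g) F = 0 := by
  rw [dlt_eq_sum_erase _ hF, Finset.sum_congr rfl fun v hv =>
    dlt_eq_sum_erase g (F := F.erase v) (by rw [Finset.card_erase_of_mem hv]; omega)]
  exact sum_sum_erase_eq_zero F (fun v w => g ((F.erase v).erase w))
    fun v w => by rw [Finset.erase_right_comm]

theorem dlt_congr (hX : ∀ F ∈ X, ∀ G ⊆ F, G ∈ X) {i : ℕ} {f g : Finset V → ZMod 2}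
    (h : ∀ F ∈ cells X i, f F = g F) {F : Finset V} (hF : F ∈ X) :
    dlt (i + 1) f F = dlt (i + 1) g F := by
  refine Finset.sum_congr rfl fun G hG => ?_
  obtain ⟨hGF, hG⟩ := Finset.mem_powersetCard.1 hG
  exact h G (mem_cells.2 ⟨hX F hF G hGF, hG⟩)

theorem wt_nonneg (i : ℕ) (F : Finset V) : 0 ≤ wt X d i F := by
  unfold wt; positivity

theorem normC_eq_sum_ite (i : ℕ) (f : Finset V → ZMod 2) :
    normC X d i f = ∑ F ∈ cells X i, if f F ≠ 0 then wt X d i F else 0 :=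
  Finset.sum_filter _ _

theorem normC_nonneg (i : ℕ) (f : Finset V → ZMod 2) : 0 ≤ normC X d i f :=
  Finset.sum_nonneg fun F _ => wt_nonneg i F

theorem normC_congr {i : ℕ} {f g : Finset V → ZMod 2} (h : ∀ F ∈ cells X i, f F = g F) :
    normC X d i f = normC X d i g := by
  rw [normC_eq_sum_ite, normC_eq_sum_ite]
  exact Finset.sum_congr rfl fun F hF => by rw [h F hF]

theorem normC_zero (i : ℕ) : normC X d i (fun _ => 0) = 0 := by
  simp [normC_eq_sum_ite]

theorem normC_add_le (i : ℕ) (f g : Finset V → ZMod 2) :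
    normC X d i (fun F => f F + g F) ≤ normC X d i f + normC X d i g := by
  simp only [normC_eq_sum_ite]
  rw [← Finset.sum_add_distrib]
  refine Finset.sum_le_sum fun F _ => ?_
  have := wt_nonneg (X := X) (d := d) i F
  by_cases hf : f F = 0
  · simp [hf]
  · rw [if_pos hf]
    split_ifs <;> linarith

theorem normC_sum_le {ι : Type*} (i : ℕ) (s : Finset ι) (f : ι → Finset V → ZMod 2) :
    normC X d i (fun F => ∑ a ∈ s, f a F) ≤ ∑ a ∈ s, normC X d i (f a) := by
  induction s using Finset.induction_on with
  | empty => simp [normC_zero]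
  | insert a s ha ih =>
    simp only [Finset.sum_insert ha]
    exact (normC_add_le _ _ _).trans (by gcongr)

theorem sum_faceDeg (S : Finset (Finset V)) :
    ∑ F ∈ S, faceDeg X d F = ∑ G ∈ cells X d, (S.filter (· ⊆ G)).card := by
  have h : ∀ F, faceDeg X d F = ((cells X d).filter (F ⊆ ·)).card := by
    intro F
    rw [faceDeg, cells, Finset.filter_filter]
  simp only [h]
  exact Finset.sum_card_bipartiteAbove_eq_sum_card_bipartiteBelow (fun F G : Finset V => F ⊆ G)

theorem normC_eq_div (i : ℕ) (f : Finset V → ZMod 2) :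
    normC X d i f = ((∑ G ∈ cells X d,
      (((cells X i).filter fun F => f F ≠ 0).filter (· ⊆ G)).card : ℕ) : ℝ)
        / (((d + 1).choose (i + 1) : ℝ) * ((cells X d).card : ℝ)) := by
  rw [normC, ← sum_faceDeg, Nat.cast_sum, Finset.sum_div]
  rfl

theorem normC_le_of_support {i : ℕ} (hi : i ≤ d) (f : Finset V → ZMod 2)
    (A : Finset (Finset V))
    (h : ∀ F ∈ cells X i, f F ≠ 0 → ∀ G ∈ cells X d, F ⊆ G → G ∈ A) :
    normC X d i f ≤ (A.card : ℝ) / ((cells X d).card : ℝ) := by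
  have hchoose : 0 < (d + 1).choose (i + 1) := Nat.choose_pos (by omega)
  have hsum : ∑ G ∈ cells X d, (((cells X i).filter fun F => f F ≠ 0).filter (· ⊆ G)).card
      ≤ A.card * (d + 1).choose (i + 1) := by
    have hle : ∀ G ∈ cells X d,
        (((cells X i).filter fun F => f F ≠ 0).filter (· ⊆ G)).card
          ≤ if G ∈ A then (d + 1).choose (i + 1) else 0 := by
      intro G hG
      split_ifs with hGA
      · rw [← (mem_cells.1 hG).2, ← Finset.card_powersetCard]
        refine Finset.card_le_card fun F hF => ?_
        simp only [Finset.mem_filter, mem_cells] at hF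
        exact Finset.mem_powersetCard.2 ⟨hF.2, hF.1.1.2⟩
      · rw [Nat.le_zero, Finset.card_eq_zero, Finset.filter_eq_empty_iff]
        intro F hF hFG
        rw [Finset.mem_filter] at hF
        exact hGA (h F hF.1 hF.2 G hG hFG)
    refine (Finset.sum_le_sum hle).trans ?_
    rw [← Finset.sum_filter, Finset.sum_const, smul_eq_mul]
    gcongr
    exact fun G hG => (Finset.mem_filter.1 hG).2
  have hchoose' : ((d + 1).choose (i + 1) : ℝ) ≠ 0 := by exact_mod_cast hchoose.ne'
  rw [normC_eq_div, ← mul_div_mul_left (A.card : ℝ) _ hchoose', mul_comm _ (A.card : ℝ)]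
  gcongr
  exact_mod_cast hsum

theorem normC_eq_one (hX : ∀ F ∈ X, ∀ G ⊆ F, G ∈ X) (hne : (cells X d).Nonempty) {i : ℕ}
    (hi : i ≤ d) {f : Finset V → ZMod 2} (h : ∀ F ∈ cells X i, f F = 1) :
    normC X d i f = 1 := by
  have hchoose : 0 < (d + 1).choose (i + 1) := Nat.choose_pos (by omega)
  have hcard : ∀ G ∈ cells X d,
      (((cells X i).filter fun F => f F ≠ 0).filter (· ⊆ G)).card
        = (d + 1).choose (i + 1) := by
    intro G hG
    rw [← (mem_cells.1 hG).2, ← Finset.card_powersetCard]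
    congr 1
    ext F
    simp only [Finset.mem_filter, Finset.mem_powersetCard]
    refine ⟨fun hF => ⟨hF.2, (mem_cells.1 hF.1.1).2⟩, fun hF => ?_⟩
    have hF' : F ∈ cells X i := mem_cells.2 ⟨hX G (mem_cells.1 hG).1 F hF.1, hF.2⟩
    exact ⟨⟨hF', by simp [h F hF']⟩, hF.1⟩
  rw [normC_eq_div, Finset.sum_congr rfl hcard, Finset.sum_const, smul_eq_mul]
  have : (0 : ℝ) < (cells X d).card := by exact_mod_cast hne.card_pos
  have : (0 : ℝ) < (d + 1).choose (i + 1) := by exact_mod_cast hchoose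
  push_cast
  field_simp

theorem finite_range_normC (i : ℕ) : (Set.range (normC X d i)).Finite := by
  refine ((cells X i).powerset.image fun S => ∑ F ∈ S, wt X d i F).finite_toSet.subset ?_
  rintro _ ⟨f, rfl⟩
  exact Finset.mem_coe.2 (Finset.mem_image.2
    ⟨_, Finset.mem_powerset.2 (Finset.filter_subset (fun F => f F ≠ 0) _), rfl⟩)

theorem exists_normC_eq_distB (i : ℕ) (f : Finset V → ZMod 2) :
    ∃ g : Finset V → ZMod 2, distB X d i f = normC X d i (fun F => f F + dlt i g F) := by
  refine Set.Nonempty.csInf_mem (s := {r : ℝ | ∃ g : Finset V → ZMod 2,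
    r = normC X d i (fun F => f F + dlt i g F)}) ⟨_, 0, rfl⟩ ?_
  refine (finite_range_normC (X := X) (d := d) i).subset ?_
  rintro _ ⟨g, rfl⟩
  exact ⟨_, rfl⟩

variable {ε : ℝ}

theorem memB_of_dlt_eq_zero (hε : 0 < ε)
    (hexp : ∀ i < d, ∀ f : Finset V → ZMod 2, ¬ MemB X i f →
      ε ≤ normC X d (i + 1) (dlt (i + 1) f) / distB X d i f)
    {i : ℕ} (hi : i < d) {f : Finset V → ZMod 2}
    (hf : ∀ F ∈ cells X (i + 1), dlt (i + 1) f F = 0) : MemB X i f := by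
  by_contra h
  have := hexp i hi f h
  rw [normC_congr hf, normC_zero, zero_div] at this
  linarith

/-- A coboundary has a cobounding cochain of norm controlled by the expansion. -/
theorem exists_dlt_eq_of_memB (hX : ∀ F ∈ X, ∀ G ⊆ F, G ∈ X) (hε : 0 < ε)
    (hexp : ∀ i < d, ∀ f : Finset V → ZMod 2, ¬ MemB X i f →
      ε ≤ normC X d (i + 1) (dlt (i + 1) f) / distB X d i f)
    {i : ℕ} (hi : i < d) {g : Finset V → ZMod 2} (hg : MemB X (i + 1) g) :
    ∃ h : Finset V → ZMod 2, (∀ F ∈ cells X (i + 1), dlt (i + 1) h F = g F) ∧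
      normC X d i h ≤ normC X d (i + 1) g / ε ∧
      ((∀ F ∈ cells X (i + 1), g F = 0) → h = fun _ => 0) := by
  by_cases h0 : ∀ F ∈ cells X (i + 1), g F = 0
  · refine ⟨fun _ => 0, fun F hF => ?_, ?_, fun _ => rfl⟩
    · rw [h0 F hF]; simp [dlt]
    · rw [normC_zero]; exact div_nonneg (normC_nonneg _ _) hε.le
  obtain ⟨f, hf⟩ := hg
  obtain ⟨k, hk⟩ := exists_normC_eq_distB (X := X) (d := d) i f
  have hnot : ¬ MemB X i f := by
    rintro ⟨k, hk⟩
    refine h0 fun F hF => ?_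
    rw [hf F hF, dlt_congr hX hk (mem_cells.1 hF).1, dlt_dlt k (mem_cells.1 hF).2]
  refine ⟨fun F => f F + dlt i k F, fun F hF => ?_, ?_, fun h => absurd h h0⟩
  · rw [dlt_add, dlt_dlt k (mem_cells.1 hF).2, hf F hF, add_zero]
  · have h := hexp i hi f hnot
    rw [normC_congr fun F hF => (hf F hF).symm] at h
    have hdist : 0 ≤ distB X d i f := hk ▸ normC_nonneg _ _
    have hpos : 0 < distB X d i f := by
      refine hdist.lt_of_ne fun h' => ?_
      rw [← h', div_zero] at h
      linarith
    rw [← hk, le_div_iff₀ hε, mul_comm]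
    exact (le_div_iff₀ hpos).1 h

end Expansion

section IntersectionCochains

/-- The bound, relative to that of the intersection cochains, for the homotopy on grid cells of
dimension `k`. -/
noncomputable def homotopyBound (ε : ℝ) : ℕ → ℝ
  | 0 => 1 / ε
  | k + 1 => (1 + 2 * (k + 1) * homotopyBound ε k) / ε

theorem homotopyBound_nonneg {ε : ℝ} (hε : 0 < ε) (k : ℕ) : 0 ≤ homotopyBound ε k := by
  induction k with
  | zero => exact (one_div_pos.2 hε).le
  | succ k ih => rw [homotopyBound]; positivity

variable {d : ℕ}

/-- The sum of `h` over the faces of the grid cell with base point `q` and directions `S`. -/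
def gridBoundary (h : (Fin d → ℤ) → Finset (Fin d) → Finset V → ZMod 2) (q : Fin d → ℤ)
    (S : Finset (Fin d)) (F : Finset V) : ZMod 2 :=
  ∑ m ∈ S, (h q (S.erase m) F + h (q + Pi.single m 1) (S.erase m) F)

theorem gridBoundary_gridBoundary (h : (Fin d → ℤ) → Finset (Fin d) → Finset V → ZMod 2)
    (q : Fin d → ℤ) (S : Finset (Fin d)) (F : Finset V) :
    gridBoundary (gridBoundary h) q S F = 0 := by
  unfold gridBoundary
  simp only [← Finset.sum_add_distrib]
  refine sum_sum_erase_eq_zero S (fun m k => h q ((S.erase m).erase k) F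
    + h (q + Pi.single k 1) ((S.erase m).erase k) F
    + (h (q + Pi.single m 1) ((S.erase m).erase k) F
    + h (q + Pi.single m 1 + Pi.single k 1) ((S.erase m).erase k) F)) fun m k => ?_
  rw [Finset.erase_right_comm, add_right_comm q (Pi.single m 1)]
  ring

theorem finite_gridBoundary_ne_zero {h : (Fin d → ℤ) → Finset (Fin d) → Finset V → ZMod 2}
    {S : Finset (Fin d)} (hfin : ∀ m ∈ S, {q | h q (S.erase m) ≠ fun _ => 0}.Finite) :
    {q | gridBoundary h q S ≠ fun _ => 0}.Finite := by
  have hfin' : ∀ m ∈ S, ({q | h q (S.erase m) ≠ fun _ => 0}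
      ∪ {q | h (q + Pi.single m 1) (S.erase m) ≠ fun _ => 0}).Finite := fun m hm =>
    (hfin m hm).union ((hfin m hm).preimage (add_left_injective (Pi.single m 1)).injOn)
  refine (S.finite_toSet.biUnion hfin').subset fun q hq => ?_
  by_contra hcon
  refine hq (funext fun F => Finset.sum_eq_zero fun m hm => ?_)
  simp only [Set.mem_iUnion, not_exists, Set.mem_union, Set.mem_ofPred_eq, not_or,
    not_not] at hcon
  obtain ⟨h₁, h₂⟩ := hcon m hm
  rw [h₁, h₂, add_zero]

variable [DecidableEq V] {X : Finset (Finset V)} {ε θ : ℝ}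

theorem dlt_gridBoundary (j : ℕ) (h : (Fin d → ℤ) → Finset (Fin d) → Finset V → ZMod 2)
    (q : Fin d → ℤ) (S : Finset (Fin d)) (F : Finset V) :
    dlt j (gridBoundary h q S) F = gridBoundary (fun q S => dlt j (h q S)) q S F := by
  unfold gridBoundary
  rw [dlt_sum]
  exact Finset.sum_congr rfl fun m _ => dlt_add _ _ _ _

theorem normC_gridBoundary_le {h : (Fin d → ℤ) → Finset (Fin d) → Finset V → ZMod 2} {i : ℕ}
    {b : ℝ} {q : Fin d → ℤ} {S : Finset (Fin d)}
    (hb : ∀ q, ∀ m ∈ S, normC X d i (h q (S.erase m)) ≤ b) :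
    normC X d i (gridBoundary h q S) ≤ 2 * S.card * b := by
  unfold gridBoundary
  refine (normC_sum_le _ _ _).trans ?_
  calc ∑ m ∈ S, normC X d i (fun F => h q (S.erase m) F
        + h (q + Pi.single m 1) (S.erase m) F)
      ≤ ∑ m ∈ S, (b + b) := Finset.sum_le_sum fun m hm =>
        (normC_add_le _ _ _).trans (add_le_add (hb _ m hm) (hb _ m hm))
    _ = 2 * S.card * b := by rw [Finset.sum_const, nsmul_eq_mul]; ring

/-- A family of cochains on `X` indexed by the cells of the grid `ℤᵈ` which behaves like the
intersection numbers of the grid cells with the images of the faces of `X`. -/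
structure IsIntersectionFamily (X : Finset (Finset V)) (θ : ℝ)
    (I : (Fin d → ℤ) → Finset (Fin d) → Finset V → ZMod 2) : Prop where
  dlt_eq : ∀ q S, ∀ F ∈ X, ∀ j, F.card = j + 1 → dlt j (I q S) F = gridBoundary I q S F
  norm_le : ∀ q S, normC X d (d - S.card) (I q S) ≤ θ
  finite_support : ∃ B : Set (Fin d → ℤ), B.Finite ∧ ∀ q ∉ B, ∀ S, ∀ F ∈ X, I q S F = 0

namespace IsIntersectionFamily

variable {I : (Fin d → ℤ) → Finset (Fin d) → Finset V → ZMod 2}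

theorem dlt_add_gridBoundary (hI : IsIntersectionFamily X θ I)
    {h : (Fin d → ℤ) → Finset (Fin d) → Finset V → ZMod 2} {q : Fin d → ℤ}
    {S : Finset (Fin d)} {F : Finset V} (hF : F ∈ X) {j : ℕ} (hj : F.card = j + 1)
    (hh : ∀ q', ∀ m ∈ S, dlt j (h q' (S.erase m)) F
      = I q' (S.erase m) F + gridBoundary h q' (S.erase m) F) :
    dlt j (fun G => I q S G + gridBoundary h q S G) F = 0 := by
  have hsplit : gridBoundary (fun q S => dlt j (h q S)) q S F
      = gridBoundary I q S F + gridBoundary (gridBoundary h) q S F := by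
    rw [gridBoundary, gridBoundary, gridBoundary, ← Finset.sum_add_distrib]
    refine Finset.sum_congr rfl fun m hm => ?_
    rw [hh _ m hm, hh _ m hm]
    ring
  rw [dlt_add, dlt_gridBoundary, hI.dlt_eq q S F hF j hj, hsplit, gridBoundary_gridBoundary,
    add_zero, CharTwo.add_self_eq_zero]

theorem memB_vertex (hI : IsIntersectionFamily X θ I) (hd : 1 ≤ d) (q : Fin d → ℤ) :
    MemB X d (I q ∅) := by
  obtain ⟨B, hB, hzero⟩ := hI.finite_support
  let m : Fin d := ⟨0, hd⟩
  have hstep : ∀ n : ℕ, MemB X d (fun F => I q ∅ F + I (q + Pi.single m (n : ℤ)) ∅ F) := by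
    intro n
    induction n with
    | zero => exact ⟨0, fun F _ => by simp [dlt, CharTwo.add_self_eq_zero]⟩
    | succ n ih =>
      obtain ⟨g, hg⟩ := ih
      refine ⟨fun G => g G + I (q + Pi.single m (n : ℤ)) {m} G, fun F hF => ?_⟩
      have h := hI.dlt_eq (q + Pi.single m (n : ℤ)) {m} F (mem_cells.1 hF).1 d
        (mem_cells.1 hF).2
      have hm : ({m} : Finset (Fin d)).erase m = ∅ := by simp
      rw [gridBoundary, Finset.sum_singleton, hm, add_assoc, ← Pi.single_add] at h
      rw [dlt_add, ← hg F hF, h]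
      push_cast
      linear_combination - CharTwo.add_self_eq_zero (I (q + Pi.single m (n : ℤ)) ∅ F)
  have hinj : Function.Injective fun n : ℕ => q + Pi.single m (n : ℤ) := by
    intro a b hab
    have := congrFun (add_left_cancel hab) m
    simpa using this
  obtain ⟨_, ⟨n, rfl⟩, hn⟩ := (Set.infinite_range_of_injective hinj).exists_notMem_finite hB
  obtain ⟨g, hg⟩ := hstep n
  refine ⟨g, fun F hF => ?_⟩
  simpa [hzero _ hn ∅ F (mem_cells.1 hF).1] using hg F hF

/-- Inductive construction of the chain-cochain homotopy on the grid cells of dimension at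
most `k`. -/
theorem exists_homotopy (hI : IsIntersectionFamily X θ I) (hd : 1 ≤ d)
    (hX : ∀ F ∈ X, ∀ G ⊆ F, G ∈ X) (hε : 0 < ε)
    (hexp : ∀ i < d, ∀ f : Finset V → ZMod 2, ¬ MemB X i f →
      ε ≤ normC X d (i + 1) (dlt (i + 1) f) / distB X d i f) (k : ℕ) (hk : k < d) :
    ∃ h : (Fin d → ℤ) → Finset (Fin d) → Finset V → ZMod 2,
      ∀ S : Finset (Fin d), S.card ≤ k →
        (∀ q, ∀ F ∈ cells X (d - S.card),
          dlt (d - S.card) (h q S) F = I q S F + gridBoundary h q S F) ∧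
        (∀ q, normC X d (d - S.card - 1) (h q S) ≤ homotopyBound ε S.card * θ) ∧
        {q | h q S ≠ fun _ => 0}.Finite := by
  obtain ⟨B, hB, hzero⟩ := hI.finite_support
  induction k with
  | zero =>
    have := fun q => exists_dlt_eq_of_memB hX hε hexp (i := d - 1) (g := I q ∅) (by omega)
      (by rw [Nat.sub_add_cancel hd]; exact hI.memB_vertex hd q)
    rw [Nat.sub_add_cancel hd] at this
    choose h h₁ h₂ h₃ using this
    refine ⟨fun q _ => h q, fun S hS => ?_⟩
    obtain rfl : S = ∅ := Finset.card_eq_zero.1 (by omega)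
    refine ⟨fun q F hF => ?_, fun q => ?_, hB.subset fun q hq => ?_⟩
    · simpa [gridBoundary] using h₁ q F hF
    · refine (h₂ q).trans ?_
      have := hI.norm_le q ∅
      rw [Finset.card_empty, Nat.sub_zero] at this
      rw [Finset.card_empty, homotopyBound, div_mul_eq_mul_div, one_mul]
      gcongr
    · by_contra hqB
      exact hq (h₃ q fun F hF => hzero q hqB ∅ F (mem_cells.1 hF).1)
  | succ k ih =>
    obtain ⟨h, hh⟩ := ih (by omega)
    have herase : ∀ S : Finset (Fin d), S.card = k + 1 → ∀ m ∈ S, (S.erase m).card = k :=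
      fun S hS m hm => by rw [Finset.card_erase_of_mem hm, hS]; rfl
    have hnew : ∀ (q : Fin d → ℤ) (S : Finset (Fin d)), ∃ g : Finset V → ZMod 2,
        S.card = k + 1 →
        (∀ F ∈ cells X (d - (k + 1)),
          dlt (d - (k + 1)) g F = I q S F + gridBoundary h q S F) ∧
        normC X d (d - (k + 1) - 1) g ≤ homotopyBound ε (k + 1) * θ ∧
        ((∀ F ∈ cells X (d - (k + 1)), I q S F + gridBoundary h q S F = 0) →
          g = fun _ => 0) := by
      intro q S
      by_cases hS : S.card = k + 1
      swap
      · exact ⟨fun _ => 0, fun h => absurd h hS⟩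
      have hcocycle : ∀ F ∈ cells X (d - (k + 1) + 1),
          dlt (d - (k + 1) + 1) (fun G => I q S G + gridBoundary h q S G) F = 0 := by
        intro F hF
        refine hI.dlt_add_gridBoundary (mem_cells.1 hF).1 (mem_cells.1 hF).2 fun q' m hm => ?_
        have := (hh (S.erase m) (herase S hS m hm).le).1 q' F
        rw [herase S hS m hm, show d - k = d - (k + 1) + 1 by omega] at this
        exact this hF
      have hmem := memB_of_dlt_eq_zero hε hexp (by omega) hcocycle
      obtain ⟨g, h₁, h₂, h₃⟩ := exists_dlt_eq_of_memB hX hε hexp (i := d - (k + 1) - 1)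
        (g := fun G => I q S G + gridBoundary h q S G) (by omega)
        (by rw [Nat.sub_add_cancel (by omega)]; exact hmem)
      rw [Nat.sub_add_cancel (by omega)] at h₁ h₂ h₃
      refine ⟨g, fun _ => ⟨h₁, h₂.trans ?_, h₃⟩⟩
      have hI' := hI.norm_le q S
      have hb : normC X d (d - (k + 1)) (gridBoundary h q S)
          ≤ 2 * S.card * (homotopyBound ε k * θ) := by
        refine normC_gridBoundary_le fun q' m hm => ?_
        have hc := herase S hS m hm
        have := (hh (S.erase m) hc.le).2.1 q'
        rwa [hc, Nat.sub_sub] at this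
      rw [hS] at hI' hb
      rw [homotopyBound, div_mul_eq_mul_div]
      gcongr
      refine (normC_add_le _ _ _).trans ((add_le_add hI' hb).trans (le_of_eq ?_))
      push_cast
      ring
    choose g hg using hnew
    refine ⟨fun q S => if S.card = k + 1 then g q S else h q S, fun S hS => ?_⟩
    have hbd : ∀ q, gridBoundary (fun q S => if S.card = k + 1 then g q S else h q S) q S
        = gridBoundary h q S := by
      intro q
      funext F
      refine Finset.sum_congr rfl fun m hm => ?_
      have : (S.erase m).card ≠ k + 1 := by
        rw [Finset.card_erase_of_mem hm]
        have := Finset.card_pos.2 ⟨m, hm⟩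
        omega
      simp only [if_neg this]
    simp only [hbd]
    by_cases hSk : S.card = k + 1
    · simp only [if_pos hSk]
      rw [hSk]
      refine ⟨fun q => (hg q S hSk).1, fun q => (hg q S hSk).2.1, ?_⟩
      have hfin := finite_gridBoundary_ne_zero (h := h) (S := S)
        fun m hm => (hh (S.erase m) (herase S hSk m hm).le).2.2
      refine (hB.union hfin).subset fun q hq => ?_
      by_contra hcon
      simp only [Set.mem_union, Set.mem_ofPred_eq, not_or, not_not] at hcon
      refine hq ((hg q S hSk).2.2 fun F hF => ?_)
      rw [hcon.2, hzero q hcon.1 S F (mem_cells.1 hF).1, add_zero]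
    · simp only [if_neg hSk]
      exact hh S (by omega)

theorem not_small (hI : IsIntersectionFamily X θ I) (hd : 1 ≤ d)
    (hX : ∀ F ∈ X, ∀ G ⊆ F, G ∈ X) (hε : 0 < ε)
    (hexp : ∀ i < d, ∀ f : Finset V → ZMod 2, ¬ MemB X i f →
      ε ≤ normC X d (i + 1) (dlt (i + 1) f) / distB X d i f)
    (hne : (cells X d).Nonempty) {v : Finset V} (hv : v ∈ cells X 0) (q₀ : Fin d → ℤ)
    (hfund : ∀ q, I q Finset.univ v = if q = q₀ then 1 else 0) :
    1 ≤ (1 + 2 * d * homotopyBound ε (d - 1)) * θ := by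
  by_contra! hlt
  obtain ⟨h, hh⟩ := hI.exists_homotopy hd hX hε hexp (d - 1) (by omega)
  have hcard : (Finset.univ : Finset (Fin d)).card = d := by simp
  have herase : ∀ m : Fin d, (Finset.univ.erase m).card = d - 1 := fun m => by
    rw [Finset.card_erase_of_mem (Finset.mem_univ m), hcard]
  have hzero : ∀ q, I q Finset.univ v + gridBoundary h q Finset.univ v = 0 := by
    intro q
    have hcocycle : ∀ F ∈ cells X (0 + 1),
        dlt (0 + 1) (fun G => I q Finset.univ G + gridBoundary h q Finset.univ G) F = 0 := by
      intro F hF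
      refine hI.dlt_add_gridBoundary (mem_cells.1 hF).1 (mem_cells.1 hF).2 fun q' m _ => ?_
      have := (hh (Finset.univ.erase m) (herase m).le).1 q' F
      rw [herase m, show d - (d - 1) = 0 + 1 by omega] at this
      exact this hF
    obtain ⟨g, hg⟩ := memB_of_dlt_eq_zero hε hexp (by omega) hcocycle
    have hconst : ∀ F ∈ cells X 0,
        I q Finset.univ F + gridBoundary h q Finset.univ F = g ∅ := by
      intro F hF
      simpa [dlt] using hg F hF
    rcases (by decide : ∀ a : ZMod 2, a = 0 ∨ a = 1) (g ∅) with h0 | h1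
    · rw [hconst v hv, h0]
    · exfalso
      have hone := normC_eq_one hX hne (Nat.zero_le d) fun F hF => (hconst F hF).trans h1
      have hI' := hI.norm_le q Finset.univ
      have hb : normC X d 0 (gridBoundary h q Finset.univ)
          ≤ 2 * (Finset.univ : Finset (Fin d)).card * (homotopyBound ε (d - 1) * θ) := by
        refine normC_gridBoundary_le fun q' m _ => ?_
        have := (hh (Finset.univ.erase m) (herase m).le).2.1 q'
        rwa [herase m, show d - (d - 1) - 1 = 0 by omega] at this
      rw [hcard, Nat.sub_self] at hI'
      rw [hcard] at hb
      have := normC_add_le (X := X) (d := d) 0 (I q Finset.univ)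
        (gridBoundary h q Finset.univ)
      nlinarith
  have hfin : ∀ m : Fin d,
      (Function.support fun q => h q (Finset.univ.erase m) v).Finite := by
    intro m
    refine (hh (Finset.univ.erase m) (herase m).le).2.2.subset fun q hq hq' => hq ?_
    simp only [hq']
  have hfin' : ∀ m : Fin d,
      (Function.support fun q => h (q + Pi.single m 1) (Finset.univ.erase m) v).Finite :=
    fun m => (hfin m).preimage (add_left_injective (Pi.single m 1)).injOn
  have hsum : ∑ᶠ q, gridBoundary h q Finset.univ v = 0 := by
    unfold gridBoundary
    rw [finsum_sum_comm]
    · refine Finset.sum_eq_zero fun m _ => ?_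
      rw [finsum_add_distrib (hfin m) (hfin' m),
        ← finsum_comp_equiv (Equiv.addRight (Pi.single m (1 : ℤ)))
          (f := fun q => h q (Finset.univ.erase m) v)]
      exact CharTwo.add_self_eq_zero _
    · exact fun m _ => ((hfin m).union (hfin' m)).subset (Function.support_add _ _)
  have hI1 : ∑ᶠ q, I q Finset.univ v = 1 := by
    rw [finsum_eq_single _ q₀ fun q hq => by rw [hfund, if_neg hq], hfund, if_pos rfl]
  have heq : ∀ q, I q Finset.univ v = gridBoundary h q Finset.univ v := fun q => by
    linear_combination hzero q - CharTwo.add_self_eq_zero (gridBoundary h q Finset.univ v)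
  rw [finsum_congr heq, hsum] at hI1
  exact zero_ne_one hI1

end IsIntersectionFamily

end IntersectionCochains

section Geometry

variable [Fintype V]

/-- The points of the standard simplex on `V` supported on `σ`. -/
def simplexFace (σ : Finset V) : Set (V → ℝ) :=
  {x | (∀ v, 0 ≤ x v) ∧ ∑ v, x v = 1 ∧ ∀ v, x v ≠ 0 → v ∈ σ}

theorem simplexFace_mono {σ τ : Finset V} (h : σ ⊆ τ) : simplexFace σ ⊆ simplexFace τ :=
  fun _ hx => ⟨hx.1, hx.2.1, fun v hv => h (hx.2.2 v hv)⟩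

theorem convex_simplexFace (σ : Finset V) : Convex ℝ (simplexFace σ) := by
  intro x hx y hy a b ha hb hab
  refine ⟨fun v => ?_, ?_, fun v hv => ?_⟩
  · exact add_nonneg (mul_nonneg ha (hx.1 v)) (mul_nonneg hb (hy.1 v))
  · simp only [Pi.add_apply, Pi.smul_apply, smul_eq_mul, Finset.sum_add_distrib,
      ← Finset.mul_sum, hx.2.1, hy.2.1, mul_one, hab]
  · by_contra hvσ
    have h₁ : x v = 0 := by_contra fun h => hvσ (hx.2.2 v h)
    have h₂ : y v = 0 := by_contra fun h => hvσ (hy.2.2 v h)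
    simp [h₁, h₂] at hv

theorem simplexFace_subset_Icc (σ : Finset V) : simplexFace σ ⊆ Set.Icc 0 1 := by
  intro x hx
  refine ⟨hx.1, fun v => ?_⟩
  rw [Pi.one_apply, ← hx.2.1]
  exact Finset.single_le_sum (fun w _ => hx.1 w) (Finset.mem_univ v)

theorem dist_le_one_of_mem_simplexFace {σ : Finset V} {x y : V → ℝ} (hx : x ∈ simplexFace σ)
    (hy : y ∈ simplexFace σ) : dist x y ≤ 1 := by
  refine (dist_pi_le_iff zero_le_one).2 fun v => ?_
  have hx' := simplexFace_subset_Icc σ hx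
  have hy' := simplexFace_subset_Icc σ hy
  have h₁ := hx'.1 v
  have h₂ := hx'.2 v
  have h₃ := hy'.1 v
  have h₄ := hy'.2 v
  simp only [Pi.zero_apply, Pi.one_apply] at h₁ h₂ h₃ h₄
  rw [Real.dist_eq, abs_le]
  constructor <;> linarith

theorem isCompact_simplexFace (σ : Finset V) : IsCompact (simplexFace σ) := by
  refine isCompact_Icc.of_isClosed_subset ?_ (simplexFace_subset_Icc σ)
  have : simplexFace σ = (⋂ v, {x | 0 ≤ x v}) ∩ {x | ∑ v, x v = 1}
      ∩ ⋂ v, ⋂ (_ : v ∉ σ), {x : V → ℝ | x v = 0} := by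
    ext x
    simp only [simplexFace, Set.mem_inter_iff, Set.mem_iInter, Set.mem_ofPred_eq]
    grind
  rw [this]
  refine ((isClosed_iInter fun v => isClosed_le continuous_const (continuous_apply v)).inter
    (isClosed_eq (by fun_prop) continuous_const)).inter
    (isClosed_iInter fun v => isClosed_iInter fun _ =>
      isClosed_eq (continuous_apply v) continuous_const)

theorem exists_mem_simplexFace {σ : Finset V} (hσ : σ ≠ ∅) : ∃ x, x ∈ simplexFace σ := by
  obtain ⟨v, hv⟩ := Finset.nonempty_iff_ne_empty.2 hσ
  refine ⟨Pi.single v 1, fun w => ?_, by simp, fun w hw => ?_⟩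
  · by_cases h : w = v
    · subst h; simp
    · simp [h]
  · by_contra h
    have : w ≠ v := fun h' => h (h' ▸ hv)
    simp [this] at hw

variable [DecidableEq V] {X : Finset (Finset V)} {d : ℕ}

theorem simplexFace_subset_realization (hX : ∀ F ∈ X, ∀ G ⊆ F, G ∈ X) {σ : Finset V}
    (hσ : σ ∈ X) : simplexFace σ ⊆ realization X := by
  intro x hx
  refine ⟨hx.1, hx.2.1, hX σ hσ _ fun v hv => ?_⟩
  exact hx.2.2 v (by simpa using hv)

theorem faceReal_eq_simplexFace (hX : ∀ F ∈ X, ∀ G ⊆ F, G ∈ X) {σ : Finset V} (hσ : σ ∈ X) :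
    faceReal X σ = simplexFace σ := by
  ext x
  exact ⟨fun hx => ⟨hx.1.1, hx.1.2.1, hx.2⟩,
    fun hx => ⟨simplexFace_subset_realization hX hσ hx, hx.2.2⟩⟩

theorem isCompact_realization (hX : ∀ F ∈ X, ∀ G ⊆ F, G ∈ X) :
    IsCompact (realization X) := by
  have : realization X = ⋃ σ ∈ X, simplexFace σ := by
    ext x
    simp only [Set.mem_iUnion]
    refine ⟨fun hx => ⟨_, hx.2.2, hx.1, hx.2.1, fun v hv => by simpa using hv⟩, ?_⟩
    rintro ⟨σ, hσ, hx⟩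
    exact simplexFace_subset_realization hX hσ hx
  rw [this]
  exact X.isCompact_biUnion fun σ _ => isCompact_simplexFace σ

/-- Some scale `ρ` is so small that the faces whose images meet a ball of radius `ρ` have a
point of their images in common. -/
theorem exists_radius (hX : ∀ F ∈ X, ∀ G ⊆ F, G ∈ X) {E : Type*} [MetricSpace E]
    {f : (V → ℝ) → E} (hf : ContinuousOn f (realization X)) :
    ∃ ρ > 0, ∀ z, ∃ z', ∀ σ ∈ X, (f '' simplexFace σ ∩ Metric.ball z ρ).Nonempty →
      z' ∈ f '' simplexFace σ := by
  let c : E → Set E := fun z => ⋂ σ ∈ X.filter (fun σ => z ∉ f '' simplexFace σ),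
    (f '' simplexFace σ)ᶜ
  have hopen : ∀ z, IsOpen (c z) := fun z => isOpen_biInter_finset fun σ hσ =>
    ((isCompact_simplexFace σ).image_of_continuousOn (hf.mono
      (simplexFace_subset_realization hX (Finset.mem_filter.1 hσ).1))).isClosed.isOpen_compl
  have hcover : f '' realization X ⊆ ⋃ z, c z := by
    refine fun z _ => Set.mem_iUnion.2 ⟨z, Set.mem_iInter₂.2 fun σ hσ => ?_⟩
    exact (Finset.mem_filter.1 hσ).2
  obtain ⟨δ, hδ, hball⟩ := lebesgue_number_lemma_of_metric
    ((isCompact_realization hX).image_of_continuousOn hf) hopen hcover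
  refine ⟨δ / 2, half_pos hδ, fun z => ?_⟩
  by_cases hz : ∃ σ ∈ X, (f '' simplexFace σ ∩ Metric.ball z (δ / 2)).Nonempty
  · obtain ⟨σ, hσ, y, hy, hyz⟩ := hz
    obtain ⟨z', hz'⟩ := hball y (Set.image_mono (simplexFace_subset_realization hX hσ) hy)
    refine ⟨z', fun τ hτ ⟨y', hy', hyz'⟩ => ?_⟩
    by_contra hcon
    have hmem : y' ∈ Metric.ball y δ := by
      rw [Metric.mem_ball] at hyz hyz' ⊢
      have := dist_triangle_right y' y z
      linarith
    exact Set.mem_iInter₂.1 (hz' hmem) τ (Finset.mem_filter.2 ⟨hτ, hcon⟩) hy'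
  · push Not at hz
    exact ⟨z, fun σ hσ h => absurd (hz σ hσ) h.ne_empty⟩

/-- The indicator of the half space `f x m < a * η`. -/
noncomputable def halfSpace {E : Type*} (f : E → Fin d → ℝ) (η : ℝ) (m : Fin d) (a : ℤ)
    (x : E) : ZMod 2 :=
  if f x m < a * η then 1 else 0

theorem halfSpace_add_halfSpace {E : Type*} (f : E → Fin d → ℝ) {η : ℝ} (hη : 0 < η)
    (m : Fin d) (a : ℤ) (x : E) :
    halfSpace f η m a x + halfSpace f η m (a + 1) x = if a = ⌊f x m / η⌋ then 1 else 0 := by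
  have h : a = ⌊f x m / η⌋ ↔ a * η ≤ f x m ∧ f x m < (a + 1) * η := by
    rw [eq_comm, Int.floor_eq_iff, le_div_iff₀ hη, div_lt_iff₀ hη]
  simp only [halfSpace, h]
  push_cast
  by_cases h₁ : f x m < a * η
  · have h₂ : f x m < (a + 1) * η := by nlinarith
    rw [if_pos h₁, if_pos h₂, if_neg fun h => absurd h.1 (not_le.2 h₁)]
    rfl
  · rw [if_neg h₁, zero_add]
    simp [not_lt.1 h₁]

theorem dist_le_of_gridCochain_ne_zero {E : Type*} {f : E → Fin d → ℝ} {η : ℝ} (hη : 0 < η)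
    {q : Fin d → ℤ} {S : Finset (Fin d)} {l : List E}
    (h : gridCochain (halfSpace f η) q S (List.finRange d) l ≠ 0)
    (hl : ∀ x ∈ l, ∀ y ∈ l, dist (f x) (f y) ≤ η) {z : E} (hz : z ∈ l) :
    dist (f z) (fun m => q m * η) ≤ 2 * η := by
  refine (dist_pi_le_iff (by positivity)).2 fun m => ?_
  have hclose : ∀ x ∈ l, |f z m - f x m| ≤ η := fun x hx => by
    rw [← Real.dist_eq]
    exact (dist_le_pi_dist _ _ m).trans (hl z hz x hx)
  obtain ⟨x, hx, y, hy, hxy⟩ := exists_of_gridCochain_ne_zero h (List.mem_finRange m)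
  have h₁ := abs_le.1 (hclose x hx)
  have h₂ := abs_le.1 (hclose y hy)
  simp only [halfSpace] at hxy
  push_cast at hxy
  rw [Real.dist_eq, abs_le]
  rcases hxy with hxy | hxy <;> split_ifs at hxy <;>
    first | exact absurd rfl hxy | constructor <;> nlinarith

theorem exists_intersectionFamily (hX : ∀ F ∈ X, ∀ G ⊆ F, G ∈ X)
    (hpure : ∀ F ∈ X, ∃ G ∈ X, G.card = d + 1 ∧ F ⊆ G) {f : (V → ℝ) → Fin d → ℝ}
    (hf : ContinuousOn f (realization X)) {ρ θ : ℝ} (hρ : 0 < ρ)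
    (hθ : ∀ z, ((((cells X d).filter fun σ =>
      (f '' simplexFace σ ∩ Metric.ball z ρ).Nonempty).card : ℝ) / (cells X d).card) ≤ θ)
    (w : V) :
    ∃ I : (Fin d → ℤ) → Finset (Fin d) → Finset V → ZMod 2, IsIntersectionFamily X θ I ∧
      ∃ q₀, ∀ q, I q Finset.univ {w} = if q = q₀ then 1 else 0 := by
  obtain ⟨η, hη, hηρ⟩ : ∃ η > 0, 2 * η < ρ := ⟨ρ / 4, by positivity, by linarith⟩
  have hcompact := isCompact_realization hX
  obtain ⟨δ, hδ, huc⟩ := Metric.uniformContinuousOn_iff.1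
    (hcompact.uniformContinuousOn_of_continuous hf) η hη
  obtain ⟨N, hN⟩ := exists_nat_gt ((d + 1) / δ)
  have hN0 : (0 : ℝ) < N := lt_of_le_of_lt (by positivity) hN
  choose! p hp using fun (σ : Finset V) (hσ : σ ≠ ∅) => exists_mem_simplexFace hσ
  let α : (Fin d → ℤ) → Finset (Fin d) → List (V → ℝ) → ZMod 2 :=
    fun q S => gridCochain (halfSpace f η) q S (List.finRange d)
  have hsupp : ∀ q S, ∀ σ ∈ X, subdivision N p σ (α q S) ≠ 0 →
      ∃ x ∈ simplexFace σ, dist (f x) (fun m => q m * η) ≤ 2 * η := by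
    intro q S σ hσ h
    obtain ⟨l, hl, hsmall⟩ := exists_of_subdivision_ne_zero (by exact_mod_cast hN0) p
      simplexFace (fun _ _ => simplexFace_mono) convex_simplexFace hp
      (fun _ _ hx _ hy => dist_le_one_of_mem_simplexFace hx hy) σ _ h
    obtain ⟨x, hx⟩ := List.exists_mem_of_ne_nil l (ne_nil_of_gridCochain_ne_zero hl)
    refine ⟨x, hsmall.1 x hx, dist_le_of_gridCochain_ne_zero hη hl (fun y hy z hz => ?_) hx⟩
    have hface := simplexFace_subset_realization hX hσ
    refine (huc y (hface (hsmall.1 y hy)) z (hface (hsmall.1 z hz))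
      ((hsmall.2 y hy z hz).trans_lt ?_)).le
    obtain ⟨G, -, hG, hσG⟩ := hpure σ hσ
    have hcard : (σ.card : ℝ) ≤ d + 1 := by exact_mod_cast hG ▸ Finset.card_le_card hσG
    rw [div_lt_iff₀ hδ] at hN
    rw [div_lt_iff₀ hN0]
    linarith
  refine ⟨fun q S σ => subdivision N p σ (α q S), ⟨?_, ?_, ?_⟩,
    fun m => ⌊f (p {w}) m / η⌋, ?_⟩
  · intro q S F _ j hj
    have hall : S.filter (· ∈ List.finRange d) = S := by simp
    rw [dlt_eq_sum_erase _ hj, ← subdivision_listCob,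
      listCob_gridCochain _ q S _ (List.nodup_finRange d), hall, subdivision_sum]
    exact Finset.sum_congr rfl fun m _ => subdivision_add _ _ _ _ _
  · intro q S
    refine (normC_le_of_support (Nat.sub_le _ _) _ _ fun F hF hne G hG hFG => ?_).trans
      (hθ fun m => q m * η)
    obtain ⟨x, hx, hdist⟩ := hsupp q S F (mem_cells.1 hF).1 hne
    exact Finset.mem_filter.2 ⟨hG, f x, ⟨x, simplexFace_mono hFG hx, rfl⟩,
      Metric.mem_ball.2 (hdist.trans_lt hηρ)⟩
  · obtain ⟨C, hC⟩ := (hcompact.image_of_continuousOn hf).isBounded.exists_norm_le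
    obtain ⟨K, hK⟩ := exists_nat_gt ((C + 2 * η) / η)
    rw [div_lt_iff₀ hη] at hK
    refine ⟨Set.Icc (fun _ => -(K : ℤ)) (fun _ => (K : ℤ)), Set.finite_Icc _ _,
      fun q hq S F hF => ?_⟩
    by_contra hne
    obtain ⟨x, hx, hdist⟩ := hsupp q S F hF hne
    have hnorm := hC (f x) ⟨x, simplexFace_subset_realization hX hF hx, rfl⟩
    have hbound : ∀ m, -(K : ℤ) ≤ q m ∧ q m ≤ K := by
      intro m
      have h₁ := abs_le.1 ((norm_le_pi_norm (f x) m).trans hnorm)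
      have h₂ := (dist_le_pi_dist (f x) (fun m => q m * η) m).trans hdist
      rw [Real.dist_eq, abs_le] at h₂
      constructor
      · have : -(K : ℝ) < q m := lt_of_mul_lt_mul_right (by linarith) hη.le
        exact_mod_cast this.le
      · have : (q m : ℝ) < K := lt_of_mul_lt_mul_right (by linarith) hη.le
        exact_mod_cast this.le
    exact hq ⟨fun m => (hbound m).1, fun m => (hbound m).2⟩
  · intro q
    simp only [α, subdivision_singleton, gridCochain_univ_singleton,
      halfSpace_add_halfSpace f hη]
    split_ifs with hq
    · refine List.prod_eq_one fun a ha => ?_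
      obtain ⟨m, -, rfl⟩ := List.mem_map.1 ha
      rw [hq, if_pos rfl]
    · obtain ⟨m, hm⟩ := Function.ne_iff.1 hq
      exact List.prod_eq_zero (List.mem_map.2 ⟨m, List.mem_finRange m, if_neg hm⟩)

end Geometry

/-- Gromov: coboundary expanders are topological expanders.  For every
`d ≥ 1` and `ε > 0` there is `ε' > 0` such that every finite pure `d`-dimensional
complex with `𝓱(X) ≥ ε` (i.e. `‖δᵢ f‖/‖[f]‖ ≥ ε` for all `i ≤ d-1` and `f ∈ Cⁱ \ Bⁱ`)
is an `ε'`-topological expander. -/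
theorem coboundary_expanders_are_topological_expanders (d : ℕ) (hd : 1 ≤ d)
    (ε : ℝ) (hε : 0 < ε) :
    ∃ ε' : ℝ, 0 < ε' ∧
      ∀ (V : Type) [Fintype V] [DecidableEq V] (X : Finset (Finset V)),
        (∀ F ∈ X, ∀ G ⊆ F, G ∈ X) →
        (∀ F ∈ X, ∃ G ∈ X, G.card = d + 1 ∧ F ⊆ G) →
        (∀ i < d, ∀ f : Finset V → ZMod 2, ¬ MemB X i f →
          ε ≤ normC X d (i + 1) (dlt (i + 1) f) / distB X d i f) →
        ∀ f : (V → ℝ) → (Fin d → ℝ), ContinuousOn f (realization X) →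
          ∃ z : Fin d → ℝ,
            ε' * ((cells X d).card : ℝ) ≤
              ({σ : Finset V | σ ∈ cells X d ∧ z ∈ f '' faceReal X σ}).ncard := by
  have hM := homotopyBound_nonneg hε (d - 1)
  set M := 1 + 2 * d * homotopyBound ε (d - 1) with hMdef
  have hMpos : 0 < M := by positivity
  refine ⟨1 / (2 * M), by positivity, ?_⟩
  intro V _ _ X hX hpure hexp f hf
  rcases (cells X d).eq_empty_or_nonempty with hempty | hne
  · exact ⟨0, by simp [hempty]⟩
  by_contra! hcon
  have hpos : (0 : ℝ) < (cells X d).card := by exact_mod_cast hne.card_pos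
  obtain ⟨ρ, hρ, hball⟩ := exists_radius hX hf
  have hθ : ∀ z, ((((cells X d).filter fun σ =>
      (f '' simplexFace σ ∩ Metric.ball z ρ).Nonempty).card : ℝ) / (cells X d).card)
        ≤ 1 / (2 * M) := by
    intro z
    obtain ⟨z', hz'⟩ := hball z
    rw [div_le_iff₀ hpos]
    refine le_trans ?_ (hcon z').le
    rw [← Set.ncard_coe_finset]
    refine Nat.cast_le.2 (Set.ncard_le_ncard (fun σ hσ => ?_)
      ((cells X d).finite_toSet.subset fun σ hσ => hσ.1))
    obtain ⟨hσ, hmeet⟩ := Finset.mem_filter.1 (Finset.mem_coe.1 hσ)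
    have hσX := (mem_cells.1 hσ).1
    exact ⟨hσ, (faceReal_eq_simplexFace hX hσX).symm ▸ hz' σ hσX hmeet⟩
  obtain ⟨G, hG⟩ := hne
  obtain ⟨w, hw⟩ : G.Nonempty := Finset.card_pos.1 (by rw [(mem_cells.1 hG).2]; omega)
  obtain ⟨I, hI, q₀, hq₀⟩ := exists_intersectionFamily hX hpure hf hρ hθ w
  have hv : {w} ∈ cells X 0 :=
    mem_cells.2 ⟨hX G (mem_cells.1 hG).1 _ (Finset.singleton_subset_iff.2 hw), by simp⟩
  have := hI.not_small hd hX hε hexp ⟨G, hG⟩ hv q₀ hq₀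
  rw [← hMdef] at this
  have hhalf : M * (1 / (2 * M)) = 1 / 2 := by field_simp
  linarith
end
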